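/- arXiv:1205.5090 — 2 statements merged into one kernel-verified Lean document; each statement's English description precedes it below -/
import Mathlib

section
/- Let G be a free group of finite rank r with free generating set S, acting on a standard Borel probability space (X, μ) by μ-preserving Borel automorphisms. Suppose that μ-almost every x ∈ X has non-trivial stabilizer, i.e. μ({x : there exists 1_G ≠ g ∈ G with g·x = x}) = 1. Then for every ε > 0 there exists 1_G ≠ g ∈ G such that μ({x ∈ X : g·x ∈ B_{|g|−1}·x}) > 1 − ε, where B_{|g|−1}·x = {h·x : h ∈ G, |h| ≤ |g| − 1}. -/
open MeasureTheory Filter Set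
open scoped ENNReal symmDiff Pointwise

namespace FPaper

/-- The free group of rank `r`; its free generating set `S` is `{FreeGroup.of i | i : Fin r}`. -/
abbrev FG (r : ℕ) := FreeGroup (Fin r)

/-- The reduced `S`-word length of a group element. -/
def wlen {r : ℕ} (g : FG r) : ℕ := g.toWord.length

/-- The ball of radius `n` in `FG r` with respect to the word length. -/
def ball (r n : ℕ) : Set (FG r) := {g | wlen g ≤ n}

instance ballFinite (r n : ℕ) : Finite (ball r n) := by
  have h : ball r n ⊆ FreeGroup.mk '' {l : List (Fin r × Bool) | l.length ≤ n} :=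
    fun g hg => ⟨g.toWord, hg, FreeGroup.mk_toWord⟩
  exact (((List.finite_length_le _ n).image _).subset h).to_subtype

/-- An action of a group `G` on a measurable space `X` by Borel automorphisms. -/
structure BorelAction (G : Type*) [Group G] (X : Type*) [MeasurableSpace X] where
  act : G → X → X
  act_one : ∀ x, act 1 x = x
  act_mul : ∀ g h x, act (g * h) x = act g (act h x)
  measurable_act : ∀ g, Measurable (act g)

namespace BorelAction

variable {G X : Type*} [Group G] [mX : MeasurableSpace X]

/-- The action preserves the measure `μ`. -/
def Preserves (T : BorelAction G X) (μ : Measure X) : Prop :=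
  ∀ g : G, MeasurePreserving (T.act g) μ μ

/-- The translated set `g · B`. -/
def smulSet (T : BorelAction G X) (g : G) (B : Set X) : Set X := T.act g⁻¹ ⁻¹' B

/-- The translated partition `g · α`, where a countable measurable partition is recorded
by a (measurable, countably-valued) function whose fibers are the cells. -/
def tr {I : Type*} (T : BorelAction G X) (g : G) (a : X → I) : X → I :=
  fun x => a (T.act g⁻¹ x)

/-- The join `F · α = ⋁_{f ∈ F} f · α` of the translates of a partition over a set `F ⊆ G`. -/
def joinF {I : Type*} (T : BorelAction G X) (F : Set G) (a : X → I) : X → (F → I) :=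
  fun x f => a (T.act (f : G)⁻¹ x)

/-- The σ-algebra generated by the partitions `f · α`, `f ∈ F`. -/
def partSA {I : Type*} (T : BorelAction G X) (F : Set G) (a : X → I) : MeasurableSpace X :=
  ⨆ f ∈ F, MeasurableSpace.comap (T.tr f a) ⊤

/-- The partition `a` is generating: the smallest `G`-invariant σ-algebra containing `a`
(i.e. the one generated by all translates of `a`) contains every measurable set up to
`ν`-null sets. -/
def Generating {I : Type*} (T : BorelAction G X) (a : X → I) (ν : Measure X) : Prop :=
  ∀ B : Set X, MeasurableSet B →
    ∃ B', MeasurableSet[T.partSA Set.univ a] B' ∧ ν (B ∆ B') = 0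


/-- Ergodicity of the action with respect to `ν`. -/
def IsErgodic (T : BorelAction G X) (ν : Measure X) : Prop :=
  ∀ B : Set X, MeasurableSet B → (∀ g : G, ν (T.smulSet g B ∆ B) = 0) → ν B = 0 ∨ ν B = 1

/-- The action is essentially free with respect to `ν`. -/
def EssentiallyFree (T : BorelAction G X) (ν : Measure X) : Prop :=
  ν {x | ∀ g : G, g ≠ 1 → T.act g x ≠ x} = 1

/-- The stabilizer subgroup of a point. -/
def stab (T : BorelAction G X) (y : X) : Subgroup G where
  carrier := {g | T.act g y = y}
  one_mem' := T.act_one y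
  mul_mem' := by
    intro g h hg hh
    simp only [Set.mem_setOf_eq] at *
    rw [T.act_mul, hh, hg]
  inv_mem' := by
    intro g hg
    simp only [Set.mem_setOf_eq] at *
    conv_lhs => rw [← hg]
    rw [← T.act_mul, inv_mul_cancel, T.act_one]

end BorelAction

/-- `m` is a `G`-invariant sub-σ-algebra. -/
def InvariantSA {G X : Type*} [Group G] (m : MeasurableSpace X) [mX : MeasurableSpace X]
    (T : BorelAction G X) : Prop :=
  m ≤ mX ∧ ∀ (g : G) (B : Set X), MeasurableSet[m] B → MeasurableSet[m] (T.act g ⁻¹' B)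

/-- A measure is purely atomic: the set of atoms has full measure. -/
def PurelyAtomic {X : Type*} [MeasurableSpace X] (ν : Measure X) : Prop :=
  ν {x | 0 < ν {x}} = 1

/-- Shannon entropy of a countable measurable partition (recorded as a countably-valued
function), with values in `[0, ∞]`. -/
noncomputable def Hpart {X I : Type*} [MeasurableSpace X] [Countable I]
    (μ : Measure X) (a : X → I) : ℝ≥0∞ :=
  ∑' i : I, ENNReal.ofReal (Real.negMulLog (μ (a ⁻¹' {i})).toReal)

/-- Conditional Shannon entropy of a countable partition given a sub-σ-algebra `m`:
`H(α/m) = ∫ ∑_{A ∈ α} φ(E[1_A | m](x)) dμ(x)` with `φ(t) = -t log t`. -/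
noncomputable def condEntS {X I : Type*} (m : MeasurableSpace X) [mX : MeasurableSpace X]
    [Countable I] (μ : Measure X) (a : X → I) : ℝ≥0∞ :=
  ∫⁻ x, ∑' i : I,
    ENNReal.ofReal (Real.negMulLog ((μ[(a ⁻¹' {i}).indicator (fun _ => (1:ℝ)) | m]) x)) ∂μ

/-- Conditional Shannon entropy of a partition given another partition:
`H(α/β) = ∑_{B ∈ β} ∑_{A ∈ α} -μ(B) · (μ(A∩B)/μ(B)) · log (μ(A∩B)/μ(B))`
(equivalently `H(α ∨ β) − H(β)`), with values in `[0, ∞]`. -/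
noncomputable def condEntP {X I J : Type*} [MeasurableSpace X] [Countable I] [Countable J]
    (μ : Measure X) (a : X → I) (b : X → J) : ℝ≥0∞ :=
  ∑' q : I × J, μ (b ⁻¹' {q.2}) *
    ENNReal.ofReal (Real.negMulLog
      ((μ (a ⁻¹' {q.1} ∩ b ⁻¹' {q.2})).toReal / (μ (b ⁻¹' {q.2})).toReal))

/-- `F_G(X, μ, S, β) = (1-2r)·H(β) + ∑_{s ∈ S} H(s·β ∨ β)`. -/
noncomputable def FF {r : ℕ} {X I : Type*} [MeasurableSpace X] [Countable I]
    (μ : Measure X) (T : BorelAction (FG r) X) (b : X → I) : ℝ :=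
  (1 - 2 * (r : ℝ)) * (Hpart μ b).toReal
    + ∑ i : Fin r, (Hpart μ (fun x => (T.tr (FreeGroup.of i) b x, b x))).toReal

/-- The sequence `n ↦ F_G(X, μ, S, B_n · α)`. -/
noncomputable def fSeq {r : ℕ} {X : Type*} [MeasurableSpace X]
    (μ : Measure X) (T : BorelAction (FG r) X) (a : X → ℕ) (n : ℕ) : ℝ :=
  FF μ T (T.joinF (ball r n) a)

/-- The f-invariant entropy `f_G(X, μ) = lim_n F_G(X, μ, S, B_n·α)`, the limit (= infimum,
since the sequence is non-increasing) of the sequence `fSeq`, with values in `[-∞, ∞)`. -/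
noncomputable def fInv {r : ℕ} {X : Type*} [MeasurableSpace X]
    (μ : Measure X) (T : BorelAction (FG r) X) (a : X → ℕ) : EReal :=
  ⨅ n : ℕ, ((fSeq μ T a n : ℝ) : EReal)

/-- Relative version `F_G(X, μ/Σ, S, β) = (1-2r)·H(β/Σ) + ∑_{s ∈ S} H(s·β ∨ β / Σ)`. -/
noncomputable def FFrel {r : ℕ} {X I : Type*} (m : MeasurableSpace X) [mX : MeasurableSpace X]
    [Countable I] (μ : Measure X) (T : BorelAction (FG r) X) (b : X → I) : ℝ :=
  (1 - 2 * (r : ℝ)) * (condEntS m μ b).toReal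
    + ∑ i : Fin r, (condEntS m μ (fun x => (T.tr (FreeGroup.of i) b x, b x))).toReal

/-- The sequence `n ↦ F_G(X, μ/Σ, S, B_n · α)`. -/
noncomputable def fSeqRel {r : ℕ} {X : Type*} (m : MeasurableSpace X) [mX : MeasurableSpace X]
    (μ : Measure X) (T : BorelAction (FG r) X) (a : X → ℕ) (n : ℕ) : ℝ :=
  FFrel m μ T (T.joinF (ball r n) a)

/-- The relative f-invariant entropy `f_G(X, μ/Σ)`, with values in `[-∞, ∞)`. -/
noncomputable def fInvRel {r : ℕ} {X : Type*} (m : MeasurableSpace X) [mX : MeasurableSpace X]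
    (μ : Measure X) (T : BorelAction (FG r) X) (a : X → ℕ) : EReal :=
  ⨅ n : ℕ, ((fSeqRel m μ T a n : ℝ) : EReal)

/-- A total order on `S ∪ S⁻¹` is recorded by an injection `ord : Fin r × Bool → ℕ`;
`g ≺ h` iff `|g| < |h|`, or `|g| = |h|` and the reduced word of `g` lexicographically
precedes that of `h`. -/
def wlt {r : ℕ} (ord : Fin r × Bool → ℕ) (g h : FG r) : Prop :=
  wlen g < wlen h ∨ (wlen g = wlen h ∧ List.Lex (fun p q => ord p < ord q) g.toWord h.toWord)

/-- `Pre(g)`: the set of elements strictly preceding `g`. -/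
def Pre {r : ℕ} (ord : Fin r × Bool → ℕ) (g : FG r) : Set (FG r) := {h | wlt ord h g}

/-- The generator or inverse generator corresponding to a letter. -/
def letter {r : ℕ} (p : Fin r × Bool) : FG r :=
  if p.2 then FreeGroup.of p.1 else (FreeGroup.of p.1)⁻¹

/-- The first (leftmost) letter of the reduced word of `g` (junk value `1` for `g = 1`). -/
def firstLetter {r : ℕ} (g : FG r) : FG r := ((g.toWord.head?).map letter).getD 1

/-- The independence decay `δ(g, α/Σ)`, as a real number:
`δ(g, α/Σ) = H(s⁻¹g·α / Pre(s⁻¹g)·α ∨ Σ) − H(g·α / Pre(g)·α ∨ Σ)` where `s` is the first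
letter of `g`. -/
noncomputable def idecay {r : ℕ} {X I : Type*} (m : MeasurableSpace X) [mX : MeasurableSpace X]
    [Countable I] (μ : Measure X) (T : BorelAction (FG r) X)
    (ord : Fin r × Bool → ℕ) (a : X → I) (g : FG r) : ℝ :=
  (condEntS (m ⊔ T.partSA (Pre ord ((firstLetter g)⁻¹ * g)) a) μ
      (T.tr ((firstLetter g)⁻¹ * g) a)).toReal
  - (condEntS (m ⊔ T.partSA (Pre ord g) a) μ (T.tr g a)).toReal

/-- The entropy `H(τ)` of a probability space: the supremum of the Shannon entropies of
finite measurable partitions. -/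
noncomputable def measEnt {M : Type*} [MeasurableSpace M] (τ : Measure M) : ℝ≥0∞ :=
  ⨆ (P : Finset (Set M)) (_ : ∀ p ∈ P, MeasurableSet p)
    (_ : (P : Set (Set M)).PairwiseDisjoint id) (_ : ⋃₀ (P : Set (Set M)) = Set.univ),
    ∑ p ∈ P, ENNReal.ofReal (Real.negMulLog (τ p).toReal)

/-- The non-negative part of an extended real, in `ℝ≥0∞`. -/
noncomputable def erealToENNReal (x : EReal) : ℝ≥0∞ :=
  if x = ⊤ then ⊤ else ENNReal.ofReal x.toReal

/-- The integral of an `EReal`-valued function (positive part minus negative part),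
with values in `[-∞, ∞]`. -/
noncomputable def eIntegral {M : Type*} [MeasurableSpace M] (τ : Measure M) (f : M → EReal) :
    EReal :=
  ((∫⁻ m, erealToENNReal (f m) ∂τ : ℝ≥0∞) : EReal)
    - ((∫⁻ m, erealToENNReal (-(f m)) ∂τ : ℝ≥0∞) : EReal)

/-- The set of `G`-invariant Borel probability measures on `X`. -/
def InvProb {G X : Type*} [Group G] [MeasurableSpace X] (T : BorelAction G X) :
    Set (Measure X) :=
  {ν | IsProbabilityMeasure ν ∧ ∀ g : G, MeasurePreserving (T.act g) ν ν}

section FreeGroupLength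

open FreeGroup

variable {α : Type*} [DecidableEq α]

/-- Every non-trivial element of a free group splits off the last letter of its reduced word. -/
theorem exists_eq_mul_letter {k : FreeGroup α} (hk : k ≠ 1) :
    ∃ (p : FreeGroup α) (t : α × Bool), k = p * mk [t] ∧ k.norm = p.norm + 1 := by
  rcases List.eq_nil_or_concat k.toWord with h | ⟨L, t, h⟩
  · exact absurd (toWord_eq_nil_iff.mp h) hk
  · have hL : IsReduced L :=
      (isReduced_toWord (x := k)).infix ⟨[], [t], by simp [h]⟩
    refine ⟨mk L, t, ?_, ?_⟩
    · rw [mul_mk, ← List.concat_eq_append, ← h, mk_toWord]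
    · simp [FreeGroup.norm, h, toWord_mk, hL.reduce_eq]

theorem norm_letter_le (t : α × Bool) : (mk [t]).norm ≤ 1 := norm_mk_le

/-- A reduced product ending in the letter `t` stays reduced when multiplied by `s⁻¹`
for a letter `s ≠ t`. -/
theorem norm_mul_letter_mul_inv {p : FreeGroup α} {s t : α × Bool} (hst : s ≠ t)
    (hp : (p * mk [t]).norm = p.norm + 1) :
    (p * mk [t] * (mk [s])⁻¹).norm = p.norm + 2 := by
  have hred : ∀ t : α × Bool, reduce [t] = [t] := fun t => IsReduced.singleton.reduce_eq
  have hword : (p * mk [t]).toWord = reduce (p.toWord ++ [t]) := by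
    rw [toWord_mul, toWord_mk, hred]
  have heq : reduce (p.toWord ++ [t]) = p.toWord ++ [t] := by
    refine (reduce.red (L := p.toWord ++ [t])).sublist.eq_of_length ?_
    rw [← hword]
    simpa [FreeGroup.norm] using hp
  have h₁ : IsReduced (p.toWord ++ [t]) := IsReduced.of_reduce_eq heq
  have h₂ : IsReduced ([t] ++ [(s.1, !s.2)]) := by
    rw [List.singleton_append, isReduced_cons_cons]
    refine ⟨fun h => ?_, IsReduced.singleton⟩
    by_contra hne
    refine hst (Prod.ext h.symm ?_)
    revert hne
    cases s.2 <;> cases t.2 <;> simp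
  have h₃ := h₁.append_overlap h₂ (by simp)
  have hinv : (mk [s])⁻¹ = mk [(s.1, !s.2)] := by simp [inv_mk, invRev]
  rw [hinv, FreeGroup.norm, toWord_mul, hword, heq, toWord_mk, hred, h₃.reduce_eq]
  simp [FreeGroup.norm]

/-- `k` extends `g` on the right without cancellation. -/
def Extends (g k : FreeGroup α) : Prop := (g * k).norm = g.norm + k.norm

theorem Extends.of_mul_letter {g p : FreeGroup α} {t : α × Bool}
    (h : Extends g (p * mk [t])) (hn : (p * mk [t]).norm = p.norm + 1) : Extends g p := by
  unfold Extends at *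
  have h₁ := norm_mul_le g p
  have h₂ := norm_mul_le (g * p) (mk [t])
  have h₃ := norm_letter_le t
  rw [mul_assoc] at h₂
  omega

theorem Extends.mul_inv_letter {g p : FreeGroup α} {s t : α × Bool} (hst : s ≠ t)
    (h : Extends g (p * mk [t])) (hn : (p * mk [t]).norm = p.norm + 1) :
    Extends g (p * mk [t] * (mk [s])⁻¹) ∧ (p * mk [t] * (mk [s])⁻¹).norm = p.norm + 2 := by
  have h₀ := norm_mul_letter_mul_inv hst hn
  have hp := h.of_mul_letter hn
  unfold Extends at *
  have hgp : (g * p * mk [t]).norm = (g * p).norm + 1 := by rw [mul_assoc]; omega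
  have h₁ := norm_mul_letter_mul_inv hst hgp
  refine ⟨?_, h₀⟩
  rw [mul_assoc g p, mul_assoc g] at h₁
  omega

theorem Extends.mul_letter {g k : FreeGroup α} (hk : k ≠ 1) (h : Extends g k) (s : α × Bool) :
    Extends g (k * mk [s]) ∧ k.norm ≤ (k * mk [s]).norm + 1 := by
  obtain ⟨p, t, rfl, hn⟩ := exists_eq_mul_letter hk
  have hs : mk [s] = (mk [(s.1, !s.2)])⁻¹ := by simp [inv_mk, invRev]
  rw [hs]
  by_cases hst : (s.1, !s.2) = t
  · rw [hst, mul_inv_cancel_right]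
    exact ⟨h.of_mul_letter hn, hn.le⟩
  · obtain ⟨h₁, h₂⟩ := h.mul_inv_letter hst hn
    exact ⟨h₁, by omega⟩

theorem Extends.mul_mk {g : FreeGroup α} (L : List (α × Bool)) :
    ∀ {k : FreeGroup α}, L.length < k.norm → Extends g k → Extends g (k * mk L) := by
  induction L with
  | nil => intro k _ h; rwa [← one_eq_mk, mul_one]
  | cons s L ih =>
    intro k hlt h
    have hk : k ≠ 1 := by rintro rfl; simp at hlt
    obtain ⟨h₁, h₂⟩ := h.mul_letter hk s
    have hsL : (mk (s :: L) : FreeGroup α) = mk [s] * mk L := by rw [FreeGroup.mul_mk]; rfl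
    rw [hsL, ← mul_assoc]
    refine ih ?_ h₁
    simp only [List.length_cons] at hlt
    omega

theorem Extends.mul {g k w : FreeGroup α} (hw : w.norm < k.norm) (h : Extends g k) :
    Extends g (k * w) := by
  have := h.mul_mk w.toWord hw
  rwa [mk_toWord] at this

theorem exists_extends {g : FreeGroup α} (hg : g ≠ 1) (n : ℕ) :
    ∃ k : FreeGroup α, Extends g k ∧ k.norm = n := by
  induction n with
  | zero => exact ⟨1, by simp [Extends], norm_one⟩
  | succ n ih =>
    obtain ⟨k, hk, hn⟩ := ih
    unfold Extends at hk
    have hgk : g * k ≠ 1 := by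
      rw [Ne, ← FreeGroup.norm_eq_zero] at hg ⊢
      omega
    obtain ⟨p, t, hpt, hlen⟩ := exists_eq_mul_letter hgk
    have hne : (t.1, !t.2) ≠ t := fun h => by simpa using congrArg Prod.snd h
    have hinv : (mk [(t.1, !t.2)])⁻¹ = mk [t] := by simp [inv_mk, invRev]
    rw [hpt] at hlen
    have h₁ := norm_mul_letter_mul_inv hne hlen
    rw [← hpt, hinv, mul_assoc] at h₁
    rw [← hpt] at hlen
    refine ⟨k * mk [t], ?_, ?_⟩
    all_goals
      unfold Extends at *
      have h₂ := norm_mul_le g (k * mk [t])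
      have h₃ := norm_mul_le k (mk [t])
      have h₄ := norm_letter_le t
      omega

theorem finite_norm_le [Finite α] (n : ℕ) : {g : FreeGroup α | g.norm ≤ n}.Finite :=
  ((List.finite_length_le _ n).image mk).subset fun g hg => ⟨g.toWord, hg, mk_toWord⟩

end FreeGroupLength

section Geodesic

open FreeGroup

variable {α : Type*} [DecidableEq α] {X : Type*} [MulAction (FreeGroup α) X]

/-- The points `x` at which `g` is a shortest element taking `x` to `g • x`. -/
def geodesicSet (X : Type*) [MulAction (FreeGroup α) X] (g : FreeGroup α) : Set X :=
  {x | ∀ h : FreeGroup α, h.norm < g.norm → g • x ≠ h • x}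

theorem preimage_geodesicSet_subset {g k : FreeGroup α} (h : Extends g k) :
    (k⁻¹ • · : X → X) ⁻¹' geodesicSet X (g * k) ⊆ geodesicSet X g := by
  intro y hy f hf heq
  refine hy (f * k) ?_ (by simpa [mul_smul] using heq)
  have := norm_mul_le f k
  unfold Extends at h
  omega

/-- If all reduced right extensions `k` of `g` with `|k| ≤ M + 1` are geodesic at `k⁻¹ • y`, then
`k ↦ k⁻¹ • y` is injective on the reduced extensions of length at most `M`. -/
theorem eq_of_inv_smul_eq {g : FreeGroup α} {y : X} {M : ℕ}
    (H : ∀ k : FreeGroup α, k.norm ≤ M + 1 → Extends g k → k⁻¹ • y ∈ geodesicSet X (g * k)) :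
    ∀ {k l : FreeGroup α}, k.norm ≤ M → l.norm ≤ M → Extends g k → Extends g l →
      k⁻¹ • y = l⁻¹ • y → k = l := by
  have key : ∀ {k l : FreeGroup α}, k.norm ≤ M + 1 → Extends g k →
      k⁻¹ • y = l⁻¹ • y → k.norm ≤ l.norm := by
    intro k l hk hgk heq
    by_contra! hlt
    refine H k hk hgk (g * l) ?_ ?_
    · have := norm_mul_le g l
      unfold Extends at hgk
      omega
    · conv_rhs => rw [heq]
      simp [mul_smul]
  suffices h : ∀ n, ∀ k l : FreeGroup α, k.norm = n → k.norm ≤ M → l.norm ≤ M → Extends g k →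
      Extends g l → k⁻¹ • y = l⁻¹ • y → k = l from fun {k l} => h _ k l rfl
  intro n
  induction n with
  | zero =>
    intro k l hn hk hl hgk hgl heq
    have := key (by omega) hgl heq.symm
    rw [FreeGroup.norm_eq_zero.mp hn, FreeGroup.norm_eq_zero.mp (by omega : l.norm = 0)]
  | succ n ih =>
    intro k l hn hk hl hgk hgl heq
    have hkl : k.norm = l.norm :=
      le_antisymm (key (by omega) hgk heq) (key (by omega) hgl heq.symm)
    obtain ⟨p, t, rfl, hp⟩ := exists_eq_mul_letter (k := k) (by rintro rfl; simp at hn)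
    obtain ⟨q, s, rfl, hq⟩ := exists_eq_mul_letter (k := l) (by rintro rfl; rw [hn, FreeGroup.norm_one] at hkl; omega)
    have hpq : ∀ u : FreeGroup α,
        (p * mk [t] * u)⁻¹ • y = (q * mk [s] * u)⁻¹ • y := by
      intro u
      rw [mul_inv_rev, mul_smul, heq, ← mul_smul, ← mul_inv_rev]
    by_cases hst : s = t
    · subst hst
      have h := hpq (mk [s])⁻¹
      simp only [mul_inv_cancel_right] at h
      rw [ih p q (by omega) (by omega) (by omega) (hgk.of_mul_letter hp)
        (hgl.of_mul_letter hq) h]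
    · obtain ⟨h₁, h₂⟩ := hgk.mul_inv_letter hst hp
      have h := key (by omega) h₁ (hpq (mk [s])⁻¹)
      rw [mul_inv_cancel_right] at h
      omega

end Geodesic

section Measure

open FreeGroup

variable {α : Type*} {X : Type*} [MulAction (FreeGroup α) X]
  [MeasurableSpace X] [StandardBorelSpace X]

theorem measurableSet_smul_eq_smul (hm : ∀ g : FreeGroup α, Measurable (g • · : X → X))
    (g h : FreeGroup α) : MeasurableSet {x : X | g • x = h • x} :=
  measurableSet_eq_fun (hm g) (hm h)

variable [DecidableEq α]

theorem measurableSet_geodesicSet [Countable α]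
    (hm : ∀ g : FreeGroup α, Measurable (g • · : X → X)) (g : FreeGroup α) :
    MeasurableSet (geodesicSet X g) := by
  have : Countable (FreeGroup α) := toWord_injective.countable
  simp only [geodesicSet, ofPred_forall]
  exact MeasurableSet.iInter fun h => MeasurableSet.iInter fun _ =>
    (measurableSet_smul_eq_smul hm g h).compl

theorem measurableSet_forall_smul_ne [Countable α]
    (hm : ∀ g : FreeGroup α, Measurable (g • · : X → X)) (N : ℕ) :
    MeasurableSet {x : X | ∀ w : FreeGroup α, w ≠ 1 → w.norm ≤ N → w • x ≠ x} := by
  have : Countable (FreeGroup α) := toWord_injective.countable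
  simp only [ofPred_forall]
  refine MeasurableSet.iInter fun w => MeasurableSet.iInter fun _ =>
    MeasurableSet.iInter fun _ => ?_
  have h := measurableSet_smul_eq_smul hm w 1
  simp only [one_smul] at h
  exact h.compl

/-- If almost every point has a non-trivial stabilizer, then the set of points without non-trivial
stabilizer elements of length at most `N` has small measure for some `N`. -/
theorem exists_measureReal_lt_of_stabilizer [Countable α] (μ : Measure X) [IsFiniteMeasure μ]
    (hm : ∀ g : FreeGroup α, Measurable (g • · : X → X))
    (hstab : ∀ᵐ x ∂μ, ∃ g : FreeGroup α, g ≠ 1 ∧ g • x = x) {c : ℝ} (hc : 0 < c) :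
    ∃ N : ℕ, μ.real {x : X | ∀ w : FreeGroup α, w ≠ 1 → w.norm ≤ N → w • x ≠ x} < c := by
  set D : ℕ → Set X := fun N => {x | ∀ w : FreeGroup α, w ≠ 1 → w.norm ≤ N → w • x ≠ x} with hD
  have hanti : Antitone D := fun m n hmn x hx w hw hwm => hx w hw (hwm.trans hmn)
  have hnull : μ (⋂ N, D N) = 0 := by
    refine measure_mono_null (fun x hx => ?_) hstab
    rintro ⟨w, hw, hwx⟩
    exact mem_iInter.mp hx w.norm w hw le_rfl hwx
  have hlim := tendsto_measure_iInter_atTop (μ := μ) (fun N =>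
    (measurableSet_forall_smul_ne hm N).nullMeasurableSet) hanti
    ⟨0, measure_ne_top μ _⟩
  rw [hnull] at hlim
  obtain ⟨N, hN⟩ := (hlim.eventually_lt_const (ENNReal.ofReal_pos.mpr hc)).exists
  exact ⟨N, (ENNReal.lt_ofReal_iff_toReal_lt (measure_ne_top μ _)).mp hN⟩

/-- If almost every point has a non-trivial stabilizer, then some non-trivial `g` is geodesic only
on a set of small measure. -/
theorem exists_measureReal_geodesicSet_lt [Finite α] [Nonempty α] (μ : Measure X)
    [IsFiniteMeasure μ] (hmp : ∀ g : FreeGroup α, MeasurePreserving (g • · : X → X) μ μ)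
    (hstab : ∀ᵐ x ∂μ, ∃ g : FreeGroup α, g ≠ 1 ∧ g • x = x) {ε : ℝ} (hε : 0 < ε) :
    ∃ g : FreeGroup α, g ≠ 1 ∧ μ.real (geodesicSet X g) < ε := by
  by_contra! hcon
  have hm : ∀ g : FreeGroup α, Measurable (g • · : X → X) := fun g => (hmp g).measurable
  have hA := measurableSet_geodesicSet (X := X) hm
  have hne : Nonempty {g : FreeGroup α // g ≠ 1} :=
    ⟨⟨of (Classical.arbitrary α), of_ne_one _⟩⟩
  set a : ℝ := ⨅ g : {g : FreeGroup α // g ≠ 1}, μ.real (geodesicSet X g.1) with ha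
  have ha_le : ∀ g : FreeGroup α, g ≠ 1 → a ≤ μ.real (geodesicSet X g) := fun g hg =>
    ciInf_le ⟨0, by rintro _ ⟨g, rfl⟩; exact measureReal_nonneg⟩
      (⟨g, hg⟩ : {g : FreeGroup α // g ≠ 1})
  have ha_pos : 0 < a := hε.trans_le (le_ciInf fun g => hcon g.1 g.2)
  obtain ⟨N, hN⟩ := exists_measureReal_lt_of_stabilizer μ hm hstab (half_pos ha_pos)
  set D : Set X := {x : X | ∀ w : FreeGroup α, w ≠ 1 → w.norm ≤ N → w • x ≠ x}
  set F := (finite_norm_le (α := α) (2 * N + 2)).toFinset with hF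
  set δ : ℝ := a / 2 / (F.card + 1) with hδ
  have hcard : (0 : ℝ) < F.card + 1 := by positivity
  have hδ_pos : 0 < δ := by positivity
  obtain ⟨⟨g, hg⟩, hgδ⟩ := exists_lt_of_ciInf_lt (lt_add_of_pos_right a hδ_pos)
  obtain ⟨k₀, hk₀, hk₀N⟩ := exists_extends hg (N + 1)
  set E : FreeGroup α → Set X := fun k =>
    {y | y ∈ geodesicSet X g ∧ Extends g k ∧ k⁻¹ • y ∉ geodesicSet X (g * k)} with hE
  have hEδ : ∀ k, μ.real (E k) ≤ δ := by
    intro k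
    by_cases hk : Extends g k
    · have hgk : g * k ≠ 1 := by
        rw [Ne, ← FreeGroup.norm_eq_zero] at hg ⊢
        unfold Extends at hk
        omega
      have hEk : E k = geodesicSet X g \ (k⁻¹ • · : X → X) ⁻¹' geodesicSet X (g * k) := by
        ext y
        simp [hE, hk]
      have h₁ : μ.real ((k⁻¹ • · : X → X) ⁻¹' geodesicSet X (g * k))
          = μ.real (geodesicSet X (g * k)) :=
        (hmp k⁻¹).measureReal_preimage (hA _).nullMeasurableSet
      rw [hEk, measureReal_sdiff (preimage_geodesicSet_subset hk) (hm k⁻¹ (hA _)), h₁]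
      have h₂ := ha_le _ hgk
      change μ.real (geodesicSet X g) < a + δ at hgδ
      linarith
    · have hEk : E k = ∅ := by
        ext y
        simp [hE, hk]
      rw [hEk, measureReal_empty]
      exact hδ_pos.le
  have hbad : μ.real ((⋃ k ∈ F, E k) ∪ (k₀⁻¹ • · : X → X) ⁻¹' D) < μ.real (geodesicSet X g) := by
    have h₁ : μ.real (⋃ k ∈ F, E k) ≤ F.card * δ :=
      (measureReal_biUnion_finset_le F E).trans
        ((Finset.sum_le_card_nsmul F _ δ fun k _ => hEδ k).trans_eq (nsmul_eq_mul _ _))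
    have h₂ : F.card * δ ≤ a / 2 := by
      rw [hδ, mul_div_assoc', div_le_iff₀ hcard]
      nlinarith
    have h₃ : μ.real ((k₀⁻¹ • · : X → X) ⁻¹' D) = μ.real D :=
      (hmp k₀⁻¹).measureReal_preimage (measurableSet_forall_smul_ne hm N).nullMeasurableSet
    have h₄ := measureReal_union_le (μ := μ) (⋃ k ∈ F, E k) ((k₀⁻¹ • · : X → X) ⁻¹' D)
    have h₅ := ha_le g hg
    linarith
  obtain ⟨y, hy, hybad⟩ : ∃ y ∈ geodesicSet X g,
      y ∉ (⋃ k ∈ F, E k) ∪ (k₀⁻¹ • · : X → X) ⁻¹' D := by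
    by_contra! hsub
    exact hbad.not_ge (measureReal_mono hsub)
  simp only [mem_union, mem_iUnion, not_or, not_exists] at hybad
  obtain ⟨hyE, hyD⟩ := hybad
  have H : ∀ k : FreeGroup α, k.norm ≤ (2 * N + 1) + 1 → Extends g k →
      k⁻¹ • y ∈ geodesicSet X (g * k) := by
    intro k hk hgk
    by_contra hnot
    exact hyE k (by simpa [hF] using hk) ⟨hy, hgk, hnot⟩
  obtain ⟨w, hw, hwN, hwy⟩ : ∃ w : FreeGroup α, w ≠ 1 ∧ w.norm ≤ N ∧
      w • k₀⁻¹ • y = k₀⁻¹ • y := by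
    simpa [D] using hyD
  have hlen := norm_mul_le k₀ w
  refine hw (left_eq_mul.mp (eq_of_inv_smul_eq H (k := k₀) (l := k₀ * w) (by omega)
    (by omega) hk₀ (hk₀.mul (by omega)) ?_))
  rw [mul_inv_rev, mul_smul, eq_inv_smul_iff, hwy]

end Measure

/-- If almost every point has non-trivial stabilizer, then for every
`ε > 0` there is `g ≠ 1` with `μ({x : g·x ∈ B_{|g|−1}·x}) > 1 − ε`. -/
theorem statement17 {r : ℕ} (hr : 1 ≤ r) {X : Type*}
    [mX : MeasurableSpace X] [StandardBorelSpace X]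
    (μ : Measure X) [IsProbabilityMeasure μ]
    (T : BorelAction (FG r) X) (hT : T.Preserves μ)
    (hstab : μ {x | ∃ g : FG r, g ≠ 1 ∧ T.act g x = x} = 1) :
    ∀ ε : ℝ, 0 < ε → ∃ g : FG r, g ≠ 1 ∧
      ENNReal.ofReal (1 - ε)
        < μ {x | ∃ h : FG r, wlen h ≤ wlen g - 1 ∧ T.act g x = T.act h x} := by
  intro ε hε
  let _ : MulAction (FG r) X :=
    { smul := T.act
      one_smul := T.act_one
      mul_smul := T.act_mul }
  have hne : Nonempty (Fin r) := ⟨⟨0, hr⟩⟩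
  have hmp : ∀ g : FG r, MeasurePreserving (g • · : X → X) μ μ := hT
  have hm : ∀ g : FG r, Measurable (g • · : X → X) := T.measurable_act
  have hcount : Countable (FG r) := FreeGroup.toWord_injective.countable
  have hmeas : MeasurableSet {x : X | ∃ g : FG r, g ≠ 1 ∧ g • x = x} := by
    simp only [ofPred_exists, ofPred_and]
    refine MeasurableSet.iUnion fun g => (MeasurableSet.const _).inter ?_
    simpa only [one_smul] using measurableSet_smul_eq_smul hm g 1
  have hae : ∀ᵐ x ∂μ, ∃ g : FG r, g ≠ 1 ∧ g • x = x :=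
    (prob_compl_eq_zero_iff hmeas).mpr hstab
  obtain ⟨g, hg, hlt⟩ := exists_measureReal_geodesicSet_lt μ hmp hae (lt_min hε one_pos)
  refine ⟨g, hg, ?_⟩
  have hpos : 0 < wlen g := Nat.pos_of_ne_zero fun h => hg (FreeGroup.norm_eq_zero.mp h)
  have hset : {x | ∃ h : FG r, wlen h ≤ wlen g - 1 ∧ T.act g x = T.act h x}
      = (geodesicSet X g)ᶜ := by
    ext x
    simp only [geodesicSet, mem_ofPred_eq, mem_compl_iff, not_forall, not_not, exists_prop]
    refine exists_congr fun h => and_congr_left fun _ => ?_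
    change wlen h ≤ wlen g - 1 ↔ wlen h < wlen g
    omega
  rw [hset, ← ofReal_measureReal,
    probReal_compl_eq_one_sub (measurableSet_geodesicSet hm g)]
  have h₁ := hlt.trans_le (min_le_left _ _)
  have h₂ := hlt.trans_le (min_le_right _ _)
  exact (ENNReal.ofReal_lt_ofReal_iff (by linarith)).mpr (by linarith)

end FPaper
end

section
/- Let G be a finitely generated free group of rank r with free generating set S, acting on a standard Borel probability space (X, μ) by μ-preserving Borel automorphisms. Suppose f_G(X, μ) is defined, the action is ergodic, and f_G(X, μ) ≠ −∞. Then either the action is essentially free (μ-almost every x ∈ X satisfies g·x ≠ x for all 1_G ≠ g ∈ G), or μ is purely atomic. -/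
open MeasureTheory Filter Set
open scoped ENNReal symmDiff Pointwise

namespace FPaper

section Entropy

variable {X : Type*} [MeasurableSpace X] {μ : Measure X}

/-- The information function of the countable partition into the fibers of `f`. -/
noncomputable def infoFn {I : Type*} (μ : Measure X) (f : X → I) (i : I) : ℝ≥0∞ :=
  ENNReal.ofReal (-Real.log (μ (f ⁻¹' {i})).toReal)

lemma lintegral_comp_countable {I : Type*} [Countable I] [MeasurableSpace I]
    [MeasurableSingletonClass I] {f : X → I} (hf : Measurable f) (F : I → ℝ≥0∞) :
    ∫⁻ x, F (f x) ∂μ = ∑' i, F i * μ (f ⁻¹' {i}) := by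
  rw [← lintegral_map (measurable_of_countable F) hf, lintegral_countable']
  refine tsum_congr fun i => ?_
  rw [Measure.map_apply hf (measurableSet_singleton i)]

lemma ae_fiber_pos {I : Type*} [Countable I] (f : X → I) :
    ∀ᵐ x ∂μ, 0 < μ (f ⁻¹' {f x}) := by
  have h : μ (⋃ i ∈ {i | μ (f ⁻¹' {i}) = 0}, f ⁻¹' {i}) = 0 :=
    (measure_biUnion_null_iff (Set.to_countable _)).2 fun i hi => hi
  refine measure_mono_null (fun x hx => ?_) h
  exact Set.mem_biUnion (x := f x) (by simpa using hx) rfl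

lemma Hpart_comp_measurePreserving {I : Type*} [Countable I] [MeasurableSpace I]
    [MeasurableSingletonClass I] {f : X → I} (hf : Measurable f) {t : X → X}
    (ht : MeasurePreserving t μ μ) : Hpart μ (fun x => f (t x)) = Hpart μ f := by
  refine tsum_congr fun i => ?_
  have : (fun x => f (t x)) ⁻¹' {i} = t ⁻¹' (f ⁻¹' {i}) := rfl
  rw [this, ht.measure_preimage (hf (measurableSet_singleton i)).nullMeasurableSet]

lemma tsum_measure_fiber_inter {I K : Type*} [Countable I] [MeasurableSpace I]
    [MeasurableSingletonClass I] [MeasurableSpace K] [MeasurableSingletonClass K]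
    {f : X → I} {k : X → K} (hf : Measurable f) (hk : Measurable k) (c : K) :
    ∑' i, μ ((fun x => (f x, k x)) ⁻¹' {(i, c)}) = μ (k ⁻¹' {c}) := by
  rw [← measure_iUnion]
  · congr 1
    ext x
    simp
  · intro i j hij
    refine Set.disjoint_left.2 fun x hx hy => hij ?_
    simp only [mem_preimage, mem_singleton_iff, Prod.mk.injEq] at hx hy
    exact hx.1.symm.trans hy.1
  · exact fun i => (hf.prodMk hk) (measurableSet_singleton _)

variable [IsProbabilityMeasure μ]

lemma Hpart_eq_lintegral {I : Type*} [Countable I] [MeasurableSpace I]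
    [MeasurableSingletonClass I] {f : X → I} (hf : Measurable f) :
    Hpart μ f = ∫⁻ x, infoFn μ f (f x) ∂μ := by
  rw [lintegral_comp_countable hf]
  refine tsum_congr fun i => ?_
  have h : Real.negMulLog (μ (f ⁻¹' {i})).toReal
      = (-Real.log (μ (f ⁻¹' {i})).toReal) * (μ (f ⁻¹' {i})).toReal := by
    simp [Real.negMulLog]; ring
  rw [h, ENNReal.ofReal_mul' ENNReal.toReal_nonneg, ENNReal.ofReal_toReal (measure_ne_top _ _)]
  rfl

/-- A partition which is almost everywhere determined by another one has smaller entropy. -/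
lemma Hpart_le_of_determined {I J : Type*} [Countable I] [MeasurableSpace I]
    [MeasurableSingletonClass I] [Countable J] [MeasurableSpace J] [MeasurableSingletonClass J]
    {f : X → I} {g : X → J} (hf : Measurable f) (hg : Measurable g) {s : Set X}
    (hs : ∀ᵐ x ∂μ, x ∈ s) (h : ∀ x ∈ s, ∀ y ∈ s, g x = g y → f x = f y) :
    Hpart μ f ≤ Hpart μ g := by
  rw [Hpart_eq_lintegral hf, Hpart_eq_lintegral hg]
  refine lintegral_mono_ae ?_
  filter_upwards [hs, ae_fiber_pos (μ := μ) g] with x hx hpos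
  refine ENNReal.ofReal_le_ofReal (neg_le_neg ?_)
  refine Real.log_le_log (ENNReal.toReal_pos hpos.ne' (measure_ne_top _ _)) ?_
  refine ENNReal.toReal_mono (measure_ne_top _ _) (measure_mono_ae ?_)
  filter_upwards [hs] with y hy hgy
  exact h y hy x hx hgy

lemma Hpart_congr_of_determined {I J : Type*} [Countable I] [MeasurableSpace I]
    [MeasurableSingletonClass I] [Countable J] [MeasurableSpace J] [MeasurableSingletonClass J]
    {f : X → I} {g : X → J} (hf : Measurable f) (hg : Measurable g)
    (h : ∀ x y, g x = g y ↔ f x = f y) : Hpart μ f = Hpart μ g :=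
  le_antisymm
    (Hpart_le_of_determined hf hg (s := univ) (by simp) fun x _ y _ => (h x y).1)
    (Hpart_le_of_determined hg hf (s := univ) (by simp) fun x _ y _ => (h x y).2)

/-- Strong subadditivity of Shannon entropy. -/
lemma Hpart_submodular {I J K : Type*} [Countable I] [MeasurableSpace I]
    [MeasurableSingletonClass I] [Countable J] [MeasurableSpace J] [MeasurableSingletonClass J]
    [Countable K] [MeasurableSpace K] [MeasurableSingletonClass K]
    {f : X → I} {g : X → J} {k : X → K} (hf : Measurable f) (hg : Measurable g)
    (hk : Measurable k) :
    Hpart μ (fun x => (f x, g x, k x)) + Hpart μ k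
      ≤ Hpart μ (fun x => (f x, k x)) + Hpart μ (fun x => (g x, k x)) := by
  have hfk := hf.prodMk hk
  have hgk := hg.prodMk hk
  have ht : Measurable (fun x => (f x, g x, k x)) := hf.prodMk hgk
  set t : X → I × J × K := fun x => (f x, g x, k x) with ht_def
  set fk : X → I × K := fun x => (f x, k x) with hfk_def
  set gk : X → J × K := fun x => (g x, k x) with hgk_def
  let ratio : I × J × K → ℝ≥0∞ := fun q =>
    μ (fk ⁻¹' {(q.1, q.2.2)}) * μ (gk ⁻¹' {q.2})
      / (μ (k ⁻¹' {q.2.2}) * μ (t ⁻¹' {q}))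
  have hratio : ∫⁻ x, ratio (t x) ∂μ ≤ 1 := by
    rw [lintegral_comp_countable ht]
    calc ∑' q, ratio q * μ (t ⁻¹' {q})
        ≤ ∑' q : I × J × K, μ (fk ⁻¹' {(q.1, q.2.2)}) *
            (μ (gk ⁻¹' {q.2}) / μ (k ⁻¹' {q.2.2})) := by
          refine ENNReal.tsum_le_tsum fun q => ?_
          by_cases h0 : μ (t ⁻¹' {q}) = 0
          · simp [h0]
          · simp only [ratio, div_eq_mul_inv]
            rw [ENNReal.mul_inv (Or.inr (measure_ne_top _ _)) (Or.inl (measure_ne_top _ _))]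
            rw [← mul_assoc, mul_assoc _ _ (μ (t ⁻¹' {q})),
              ENNReal.inv_mul_cancel h0 (measure_ne_top _ _), mul_one, mul_assoc]
      _ = ∑' p : J × K, μ (k ⁻¹' {p.2}) * (μ (gk ⁻¹' {p}) / μ (k ⁻¹' {p.2})) := by
          rw [ENNReal.tsum_prod', ENNReal.tsum_comm]
          refine tsum_congr fun p => ?_
          dsimp only
          rw [ENNReal.tsum_mul_right, hfk_def, tsum_measure_fiber_inter hf hk]
      _ ≤ ∑' p : J × K, μ (gk ⁻¹' {p}) :=
          ENNReal.tsum_le_tsum fun p => ENNReal.mul_div_le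
      _ = ∫⁻ x, (fun _ : J × K => (1 : ℝ≥0∞)) (gk x) ∂μ := by
          rw [lintegral_comp_countable (F := fun _ => 1) hgk]; simp
      _ ≤ 1 := by simp
  have key : ∀ᵐ x ∂μ, infoFn μ t (t x) + infoFn μ k (k x) + 1
      ≤ infoFn μ fk (fk x) + infoFn μ gk (gk x) + ratio (t x) := by
    filter_upwards [ae_fiber_pos (μ := μ) t, ae_fiber_pos (μ := μ) k,
      ae_fiber_pos (μ := μ) fk, ae_fiber_pos (μ := μ) gk] with x h1 h2 h3 h4
    have nn : ∀ s : Set X, 0 ≤ -Real.log (μ s).toReal := fun s =>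
      neg_nonneg.2 (Real.log_nonpos ENNReal.toReal_nonneg (by
        simpa using ENNReal.toReal_mono ENNReal.one_ne_top (prob_le_one (μ := μ) (s := s))))
    have p1 := ENNReal.toReal_pos h1.ne' (measure_ne_top _ _)
    have p2 := ENNReal.toReal_pos h2.ne' (measure_ne_top _ _)
    have p3 := ENNReal.toReal_pos h3.ne' (measure_ne_top _ _)
    have p4 := ENNReal.toReal_pos h4.ne' (measure_ne_top _ _)
    have hr : ratio (t x) = ENNReal.ofReal ((μ (fk ⁻¹' {fk x})).toReal *
        (μ (gk ⁻¹' {gk x})).toReal / ((μ (k ⁻¹' {k x})).toReal * (μ (t ⁻¹' {t x})).toReal)) := by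
      rw [ENNReal.ofReal_div_of_pos (by positivity), ENNReal.ofReal_mul (by positivity),
        ENNReal.ofReal_mul (by positivity)]
      simp only [ENNReal.ofReal_toReal (measure_ne_top μ _)]
      rfl
    rw [hr, infoFn, infoFn, infoFn, infoFn, ← ENNReal.ofReal_one,
      ← ENNReal.ofReal_add (nn _) (nn _), ← ENNReal.ofReal_add (nn _) (nn _),
      ← ENNReal.ofReal_add (add_nonneg (nn _) (nn _)) zero_le_one,
      ← ENNReal.ofReal_add (add_nonneg (nn _) (nn _)) (by positivity)]
    refine ENNReal.ofReal_le_ofReal ?_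
    have hlog := Real.log_le_sub_one_of_pos (show 0 < (μ (fk ⁻¹' {fk x})).toReal *
        (μ (gk ⁻¹' {gk x})).toReal / ((μ (k ⁻¹' {k x})).toReal * (μ (t ⁻¹' {t x})).toReal)
        by positivity)
    rw [Real.log_div (by positivity) (by positivity), Real.log_mul p3.ne' p4.ne',
      Real.log_mul p2.ne' p1.ne'] at hlog
    linarith
  have m1 : Measurable fun x => infoFn μ t (t x) :=
    (measurable_of_countable (infoFn μ t)).comp ht
  have m2 : Measurable fun x => infoFn μ k (k x) :=
    (measurable_of_countable (infoFn μ k)).comp hk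
  have m3 : Measurable fun x => infoFn μ fk (fk x) :=
    (measurable_of_countable (infoFn μ fk)).comp hfk
  have m4 : Measurable fun x => infoFn μ gk (gk x) :=
    (measurable_of_countable (infoFn μ gk)).comp hgk
  have m12 : Measurable fun x => infoFn μ t (t x) + infoFn μ k (k x) := m1.add m2
  have m34 : Measurable fun x => infoFn μ fk (fk x) + infoFn μ gk (gk x) := m3.add m4
  have hintegral := lintegral_mono_ae key
  rw [lintegral_add_left m12, lintegral_add_left m1, lintegral_add_left m34,
    lintegral_add_left m3, ← Hpart_eq_lintegral ht, ← Hpart_eq_lintegral hk,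
    ← Hpart_eq_lintegral hfk, ← Hpart_eq_lintegral hgk] at hintegral
  refine ENNReal.le_of_add_le_add_right ENNReal.one_ne_top (hintegral.trans' ?_ |>.trans ?_)
  · simp
  · gcongr

lemma Hpart_unit (f : X → Unit) : Hpart μ f = 0 := by
  have : f ⁻¹' {()} = univ := by ext; simp
  simp [Hpart, this]

lemma Hpart_prod_le {I J : Type*} [Countable I] [MeasurableSpace I]
    [MeasurableSingletonClass I] [Countable J] [MeasurableSpace J] [MeasurableSingletonClass J]
    {f : X → I} {g : X → J} (hf : Measurable f) (hg : Measurable g) :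
    Hpart μ (fun x => (f x, g x)) ≤ Hpart μ f + Hpart μ g := by
  have hu : Measurable (fun _ : X => ()) := measurable_const
  have h := Hpart_submodular (μ := μ) hf hg hu
  rw [Hpart_unit, add_zero] at h
  rwa [Hpart_congr_of_determined (hf.prodMk (hg.prodMk hu)) (hf.prodMk hg) (by simp),
    Hpart_congr_of_determined (hf.prodMk hu) hf (by simp),
    Hpart_congr_of_determined (hg.prodMk hu) hg (by simp)] at h

lemma negMulLog_le_add_of_le {m q : ℝ} (hm : 0 ≤ m) (hmq : m ≤ q) (hq : q ≤ 1) :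
    Real.negMulLog m ≤ Real.negMulLog q + q := by
  rcases hm.eq_or_lt with rfl | hm
  · simpa using add_nonneg (Real.negMulLog_nonneg hmq hq) hmq
  have hq0 := hm.trans_le hmq
  have h1 : Real.log (q / m) ≤ q / m - 1 := Real.log_le_sub_one_of_pos (by positivity)
  rw [Real.log_div hq0.ne' hm.ne'] at h1
  have h2 : m * (Real.log q - Real.log m) ≤ q - m := by
    calc _ ≤ m * (q / m - 1) := by gcongr
      _ = q - m := by field_simp
  have h3 : Real.log q ≤ 0 := Real.log_nonpos hq0.le hq
  simp only [Real.negMulLog]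
  nlinarith

/-- The partition which agrees with `q` on `D` and is trivial off `D` has small entropy when `D`
has small measure, uniformly over all `q` with a given distribution of finite entropy. -/
lemma exists_Hpart_restrict_lt {a : X → ℕ} (ha : Measurable a) (hH : Hpart μ a < ⊤) {ε : ℝ}
    (hε : 0 < ε) :
    ∃ δ > (0 : ℝ≥0∞), ∀ (q : X → ℕ) (D : Set X), MeasurableSet D → Measurable q →
      (∀ i, μ (q ⁻¹' {i}) = μ (a ⁻¹' {i})) → μ D ≤ δ →
      ∀ q' : X → ℕ, (∀ x ∈ D, q' x = q x + 1) → (∀ x ∉ D, q' x = 0) →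
        Hpart μ q' ≤ ENNReal.ofReal ε := by
  by_contra hcon
  push Not at hcon
  have hpos : ∀ n : ℕ, (0 : ℝ≥0∞) < ((n : ℝ≥0∞) + 1)⁻¹ := fun n => by simp
  choose q D hD hq hqa hμD q' hq1 hq0 hlt using fun n : ℕ => hcon _ (hpos n)
  have hDlim : Tendsto (fun n => μ (D n)) atTop (nhds 0) := by
    refine tendsto_of_tendsto_of_tendsto_of_le_of_le tendsto_const_nhds ?_ (fun _ => zero_le)
      hμD
    have := (tendsto_add_atTop_iff_nat 1).2 ENNReal.tendsto_inv_nat_nhds_zero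
    simpa using this
  have hDlim' : Tendsto (fun n => (μ (D n)).toReal) atTop (nhds 0) := by
    simpa [Function.comp_def] using (ENNReal.tendsto_toReal ENNReal.zero_ne_top).comp hDlim
  have hzero : ∀ n, q' n ⁻¹' {0} = (D n)ᶜ := fun n => by
    ext x
    by_cases hx : x ∈ D n
    · simp [hq1 n x hx, hx]
    · simp [hq0 n x hx, hx]
  have hsucc : ∀ n i, q' n ⁻¹' {i + 1} = q n ⁻¹' {i} ∩ D n := fun n i => by
    ext x
    by_cases hx : x ∈ D n
    · simp [hq1 n x hx, hx]
    · simp [hq0 n x hx, hx]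
  have le1 : ∀ s : Set X, (μ s).toReal ≤ 1 := fun s => by
    simpa using ENNReal.toReal_mono ENNReal.one_ne_top (prob_le_one (μ := μ) (s := s))
  have nn : ∀ s : Set X, 0 ≤ Real.negMulLog (μ s).toReal := fun s =>
    Real.negMulLog_nonneg ENNReal.toReal_nonneg (le1 s)
  set φ : ℕ → ℕ → ℝ := fun n i => Real.negMulLog (μ (q' n ⁻¹' {i})).toReal with hφ
  let b : ℕ → ℝ := fun i => Real.negMulLog (μ (a ⁻¹' {i})).toReal + (μ (a ⁻¹' {i})).toReal
  have hb : Summable b := by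
    refine Summable.add ?_ ?_
    · have := ENNReal.summable_toReal hH.ne
      refine this.congr fun i => ?_
      rw [ENNReal.toReal_ofReal (nn _)]
    · refine ENNReal.summable_toReal ?_
      have := lintegral_comp_countable (μ := μ) ha (fun _ => 1)
      simp only [lintegral_const, measure_univ, mul_one, one_mul] at this
      rw [← this]
      exact ENNReal.one_ne_top
  have hbound : ∀ n i, φ n (i + 1) ≤ b i := fun n i => by
    refine negMulLog_le_add_of_le ENNReal.toReal_nonneg ?_ (le1 _)
    rw [hsucc, ← hqa n i]
    exact ENNReal.toReal_mono (measure_ne_top _ _) (measure_mono inter_subset_left)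
  have hφlim : ∀ i, Tendsto (fun n => φ n i) atTop (nhds 0) := by
    intro i
    rcases i with _ | i
    · have h1 : Tendsto (fun n => (μ (q' n ⁻¹' {0})).toReal) atTop (nhds 1) := by
        have : ∀ n, (μ (q' n ⁻¹' {0})).toReal = 1 - (μ (D n)).toReal := fun n => by
          rw [hzero, prob_compl_eq_one_sub (hD n), ENNReal.toReal_sub_of_le prob_le_one
            ENNReal.one_ne_top, ENNReal.toReal_one]
        simp only [this]
        simpa using hDlim'.const_sub 1
      simpa [Function.comp_def] using (Real.continuous_negMulLog.tendsto 1).comp h1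
    · have h1 : Tendsto (fun n => (μ (q' n ⁻¹' {i + 1})).toReal) atTop (nhds 0) := by
        refine squeeze_zero (fun _ => ENNReal.toReal_nonneg) (fun n => ?_) hDlim'
        rw [hsucc]
        exact ENNReal.toReal_mono (measure_ne_top _ _) (measure_mono inter_subset_right)
      simpa [Function.comp_def] using (Real.continuous_negMulLog.tendsto 0).comp h1
  have hsum : ∀ n, Summable fun i => φ n (i + 1) := fun n =>
    Summable.of_nonneg_of_le (fun _ => nn _) (hbound n) hb
  have htail : Tendsto (fun n => ∑' i, φ n (i + 1)) atTop (nhds 0) := by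
    have := tendsto_tsum_of_dominated_convergence (f := fun n i => φ n (i + 1))
      (g := fun _ => (0 : ℝ)) hb (fun i => hφlim (i + 1))
      (Eventually.of_forall fun n i => by
        rw [Real.norm_of_nonneg (nn _)]; exact hbound n i)
    simpa using this
  have htot : Tendsto (fun n => φ n 0 + ∑' i, φ n (i + 1)) atTop (nhds 0) := by
    simpa using (hφlim 0).add htail
  obtain ⟨n, hn⟩ := (htot.eventually (gt_mem_nhds hε)).exists
  refine (hlt n).not_ge ?_
  have hs : Summable (φ n) := (summable_nat_add_iff 1).1 (hsum n)
  calc Hpart μ (q' n) = ENNReal.ofReal (∑' i, φ n i) := by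
        rw [ENNReal.ofReal_tsum_of_nonneg (fun _ => nn _) hs]
        rfl
    _ = ENNReal.ofReal (φ n 0 + ∑' i, φ n (i + 1)) := by rw [hs.tsum_eq_zero_add]
    _ ≤ ENNReal.ofReal ε := ENNReal.ofReal_le_ofReal hn.le

end Entropy

section Words

variable {r : ℕ}

/-- The generator or inverse generator given by a one-letter word. -/
def gen (p : Fin r × Bool) : FG r := FreeGroup.mk [p]

/-- The inverse letter. -/
def flip (p : Fin r × Bool) : Fin r × Bool := (p.1, !p.2)

lemma gen_inv (p : Fin r × Bool) : (gen p)⁻¹ = gen (flip p) := rfl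

lemma toWord_gen (p : Fin r × Bool) : (gen p).toWord = [p] := rfl

lemma wlen_gen (p : Fin r × Bool) : wlen (gen p) = 1 := rfl

lemma wlen_mul_le (x y : FG r) : wlen (x * y) ≤ wlen x + wlen y := FreeGroup.norm_mul_le x y

lemma wlen_gen_mul_le (p : Fin r × Bool) (g : FG r) : wlen (gen p * g) ≤ wlen g + 1 := by
  have := wlen_mul_le (gen p) g
  rw [wlen_gen] at this
  omega

lemma wlen_eq_zero {g : FG r} : wlen g = 0 ↔ g = 1 := FreeGroup.norm_eq_zero

/-- `p` and `q` can be adjacent letters of a reduced word. -/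
def Adj (p q : Fin r × Bool) : Prop := p.1 = q.1 → p.2 = q.2

lemma adj_self (p : Fin r × Bool) : Adj p p := fun _ => rfl

lemma eq_flip_of_not_adj {p q : Fin r × Bool} (h : ¬ Adj p q) : q = flip p := by
  unfold Adj at h
  push Not at h
  refine Prod.ext h.1.symm ?_
  have := h.2
  change q.2 = !p.2
  revert this
  cases p.2 <;> cases q.2 <;> simp

lemma toWord_mul_of_adj {x y : FG r}
    (h : ∀ p ∈ x.toWord.getLast?, ∀ q ∈ y.toWord.head?, Adj p q) :
    (x * y).toWord = x.toWord ++ y.toWord := by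
  rw [FreeGroup.toWord_mul]
  refine FreeGroup.IsReduced.reduce_eq ?_
  exact List.isChain_append.2 ⟨FreeGroup.isReduced_toWord, FreeGroup.isReduced_toWord, h⟩

lemma wlen_mul_of_adj {x y : FG r}
    (h : ∀ p ∈ x.toWord.getLast?, ∀ q ∈ y.toWord.head?, Adj p q) :
    wlen (x * y) = wlen x + wlen y := by
  simp [wlen, toWord_mul_of_adj h]

lemma exists_eq_gen_mul {g : FG r} (hg : g ≠ 1) :
    ∃ q g', g = gen q * g' ∧ wlen g = wlen g' + 1 := by
  obtain ⟨q, l, hl⟩ : ∃ q l, g.toWord = q :: l :=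
    List.exists_cons_of_ne_nil fun h => hg (FreeGroup.toWord_eq_nil_iff.1 h)
  have hred : FreeGroup.IsReduced (q :: l) := hl ▸ FreeGroup.isReduced_toWord
  have hl' : FreeGroup.IsReduced l := hred.infix ⟨[q], [], by simp⟩
  refine ⟨q, FreeGroup.mk l, ?_, ?_⟩
  · rw [gen, FreeGroup.mul_mk, ← FreeGroup.mk_toWord (x := g), hl]
    rfl
  · simp [wlen, hl, hl'.reduce_eq]

lemma exists_eq_mul_gen {g : FG r} (hg : g ≠ 1) :
    ∃ g' q, g = g' * gen q ∧ g.toWord = g'.toWord ++ [q] := by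
  rcases List.eq_nil_or_concat' g.toWord with h | ⟨l, q, hl⟩
  · exact absurd (FreeGroup.toWord_eq_nil_iff.1 h) hg
  have hred : FreeGroup.IsReduced (l ++ [q]) := hl ▸ FreeGroup.isReduced_toWord
  have hl' : FreeGroup.IsReduced l := hred.infix ⟨[], [q], by simp⟩
  refine ⟨FreeGroup.mk l, q, ?_, ?_⟩
  · rw [gen, FreeGroup.mul_mk, ← FreeGroup.mk_toWord (x := g), hl]
  · simp [hl, hl'.reduce_eq]

lemma head_mul_gen {c : FG r} {t : Fin r × Bool} (hc : c.toWord.head? = some t)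
    (q : Fin r × Bool) : c * gen q = 1 ∨ (c * gen q).toWord.head? = some t := by
  have hc1 : c ≠ 1 := by
    rintro rfl
    simp at hc
  obtain ⟨y, q', hy, hw⟩ := exists_eq_mul_gen hc1
  by_cases hadj : Adj q' q
  · right
    have : (c * gen q).toWord = c.toWord ++ [q] := by
      refine toWord_mul_of_adj fun p hp q₁ hq₁ => ?_
      simp only [hw, List.getLast?_append, List.getLast?_singleton, Option.some_or,
        Option.mem_def, Option.some.injEq] at hp
      simp only [toWord_gen, List.head?_cons, Option.mem_def, Option.some.injEq] at hq₁
      exact hp ▸ hq₁ ▸ hadj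
    rw [this, List.head?_append, hc]
    rfl
  · have : c * gen q = y := by
      rw [eq_flip_of_not_adj hadj, ← gen_inv, hy, mul_inv_cancel_right]
    rw [this]
    rcases hyw : y.toWord with _ | ⟨a, l⟩
    · exact Or.inl (FreeGroup.toWord_eq_nil_iff.1 hyw)
    · right
      rw [hw, hyw] at hc
      simpa using hc

lemma head_conj {c : FG r} {s t : Fin r × Bool} (hc : c.toWord.head? = some t)
    (hst : t ≠ flip s) : (gen s * c * (gen s)⁻¹).toWord.head? = some s := by
  rw [mul_assoc, gen_inv]
  rcases head_mul_gen hc (flip s) with h | h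
  · rw [h, mul_one]
    rfl
  · rw [toWord_mul_of_adj, toWord_gen]
    · rfl
    · intro p hp q hq
      simp only [toWord_gen, List.getLast?_singleton, Option.mem_def, Option.some.injEq] at hp
      rw [h, Option.mem_def, Option.some.injEq] at hq
      subst hp hq
      by_contra hadj
      exact hst (eq_flip_of_not_adj hadj)

lemma exists_head_adj (hr : 1 ≤ r) (v : FG r) :
    ∃ t, ∀ c : FG r, c.toWord.head? = some t → wlen (v * c) = wlen v + wlen c := by
  rcases hv : v.toWord.getLast? with _ | x
  · refine ⟨(⟨0, hr⟩, true), fun c _ => wlen_mul_of_adj ?_⟩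
    simp [hv]
  · refine ⟨x, fun c hc => wlen_mul_of_adj ?_⟩
    simp [hv, hc, adj_self]

lemma exists_gen_between (hr : 2 ≤ r) (v g : FG r) :
    ∃ t, wlen (v * gen t) = wlen v + 1 ∧ wlen (v * gen t * g) = wlen v + 1 + wlen g ∧
      wlen (gen t * g) = wlen g + 1 := by
  obtain ⟨t, h1, h2⟩ : ∃ t, (∀ x ∈ v.toWord.getLast?, Adj x t) ∧
      (∀ y ∈ g.toWord.head?, Adj t y) := by
    rcases hv : v.toWord.getLast? with _ | x
    · rcases hg : g.toWord.head? with _ | y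
      · exact ⟨(⟨0, by omega⟩, true), by simp, by simp⟩
      · exact ⟨y, by simp, by simp [adj_self]⟩
    · rcases hg : g.toWord.head? with _ | y
      · exact ⟨x, by simp [adj_self], by simp⟩
      · by_cases hxy : Adj x y
        · exact ⟨x, by simp [adj_self], by simp [hxy]⟩
        · have hy := eq_flip_of_not_adj hxy
          have : Nontrivial (Fin r) := Fin.nontrivial_iff_two_le.2 hr
          obtain ⟨j, hj⟩ := exists_ne x.1
          refine ⟨(j, true), ?_, ?_⟩
          · simp only [Option.mem_def, Option.some.injEq, forall_eq']
            exact fun h => absurd h.symm hj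
          · simp only [Option.mem_def, Option.some.injEq, forall_eq', hy]
            exact fun h => absurd h hj
  have hw : (v * gen t).toWord = v.toWord ++ [t] := by
    refine toWord_mul_of_adj fun p hp q hq => ?_
    simp only [toWord_gen, List.head?_cons, Option.mem_def, Option.some.injEq] at hq
    exact hq ▸ h1 p hp
  have hw' : wlen (v * gen t) = wlen v + 1 := by simp [wlen, hw]
  refine ⟨t, hw', ?_, ?_⟩
  · rw [wlen_mul_of_adj, hw']
    intro p hp q hq
    simp only [hw, List.getLast?_append, List.getLast?_singleton, Option.some_or,
      Option.mem_def, Option.some.injEq] at hp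
    exact hp ▸ h2 q hq
  · rw [wlen_mul_of_adj, wlen_gen, add_comm]
    intro p hp q hq
    simp only [toWord_gen, List.getLast?_singleton, Option.mem_def, Option.some.injEq] at hp
    exact hp ▸ h2 q hq

end Words

section Growth

/-- A sequence which almost satisfies `W (n + 1) = R * W n` with summable nonnegative defects and
which is `o(R ^ n)` has bounded partial sums. -/
lemma sum_le_of_tendsto_zero {R K : ℝ} (hR : 1 < R) {W : ℕ → ℝ} (hW : ∀ n, 0 ≤ W n)
    (hd : ∀ n, W (n + 1) ≤ R * W n)
    (hK : ∀ N, ∑ n ∈ Finset.range N, (R * W n - W (n + 1)) ≤ K)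
    (hlim : Tendsto (fun n => W n / R ^ n) atTop (nhds 0)) (N : ℕ) :
    (R - 1) * ∑ n ∈ Finset.range N, W n ≤ 2 * K := by
  set d : ℕ → ℝ := fun n => R * W n - W (n + 1) with hdd
  have hR0 : 0 < R := by linarith
  have hd0 : ∀ n, 0 ≤ d n := fun n => by simpa [hdd] using hd n
  have key : ∀ n j, R ^ j * (W n - ∑ i ∈ Finset.range j, d (n + i)) ≤ W (n + j) := by
    intro n j
    induction j with
    | zero => simp
    | succ j ih =>
      rw [Finset.sum_range_succ]
      have h1 : W (n + (j + 1)) = R * W (n + j) - d (n + j) := by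
        simp only [hdd, ← add_assoc]; ring
      have h2 : 1 ≤ R ^ (j + 1) := one_le_pow₀ hR.le
      have h3 := mul_le_mul_of_nonneg_left ih hR0.le
      have h4 := mul_le_mul_of_nonneg_right h2 (hd0 (n + j))
      rw [h1]
      calc R ^ (j + 1) * (W n - (∑ i ∈ Finset.range j, d (n + i) + d (n + j)))
          = R * (R ^ j * (W n - ∑ i ∈ Finset.range j, d (n + i))) - R ^ (j + 1) * d (n + j) := by
            ring
        _ ≤ _ := by linarith
  have hsum : ∀ n j, ∑ i ∈ Finset.range j, d (n + i) ≤ K := by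
    intro n j
    refine le_trans ?_ (hK (n + j))
    rw [Finset.sum_range_add]
    have : 0 ≤ ∑ x ∈ Finset.range n, d x := Finset.sum_nonneg fun i _ => hd0 i
    simp only [hdd] at this ⊢
    linarith
  have hWK : ∀ n, W n ≤ K := by
    intro n
    have h1 : ∀ j, (W n - K) / R ^ n ≤ W (j + n) / R ^ (j + n) := by
      intro j
      rw [div_le_div_iff₀ (by positivity) (by positivity), pow_add, ← mul_assoc]
      refine mul_le_mul_of_nonneg_right ?_ (by positivity)
      have := key n j
      have h2 := hsum n j
      rw [add_comm j n, mul_comm]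
      refine le_trans ?_ this
      exact mul_le_mul_of_nonneg_left (by linarith) (by positivity)
    have h2 := ge_of_tendsto' ((tendsto_add_atTop_iff_nat n).2 hlim) h1
    have h3 : 0 < R ^ n := by positivity
    by_contra hcon
    push Not at hcon
    have : 0 < (W n - K) / R ^ n := div_pos (by linarith) h3
    linarith
  have htel : (R - 1) * ∑ n ∈ Finset.range N, W n = W N - W 0 + ∑ n ∈ Finset.range N, d n := by
    rw [← Finset.sum_range_sub, Finset.mul_sum, ← Finset.sum_add_distrib]
    refine Finset.sum_congr rfl fun n _ => ?_
    simp only [hdd]; ring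
  have := hK N
  have h2 := hWK N
  have h3 := hW 0
  rw [htel]
  simp only [hdd]
  linarith

/-- If a nonnegative sequence with growth rate at most `R` loses, for every `ε`, a fixed
proportion of its size up to an error `ε * R ^ n`, then it is `o(R ^ n)`. -/
lemma tendsto_div_pow_zero {R C : ℝ} (hR : 0 < R) {a : ℕ → ℝ} (ha : ∀ n, 0 ≤ a n)
    (hgrow : ∀ n, a (n + 1) ≤ R * a n)
    (hloss : ∀ ε > 0, ∃ l, ∀ n, a (n + l) ≤ (R ^ l - 1) * a n + ε * (C * R ^ n)) :
    Tendsto (fun n => a n / R ^ n) atTop (nhds 0) := by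
  have hanti : Antitone fun n => a n / R ^ n := by
    refine antitone_nat_of_succ_le fun n => ?_
    rw [div_le_div_iff₀ (by positivity) (by positivity), pow_succ]
    have := mul_le_mul_of_nonneg_right (hgrow n) (by positivity : 0 ≤ R ^ n)
    linarith
  have hbdd : BddBelow (range fun n => a n / R ^ n) :=
    ⟨0, by rintro _ ⟨n, rfl⟩; exact div_nonneg (ha n) (by positivity)⟩
  have hL := tendsto_atTop_ciInf hanti hbdd
  set L := ⨅ n, a n / R ^ n
  have hL0 : 0 ≤ L := ge_of_tendsto' hL fun n => div_nonneg (ha n) (by positivity)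
  have hLε : ∀ ε > 0, L ≤ ε * C := by
    intro ε hε
    obtain ⟨l, hl⟩ := hloss ε hε
    have hRl : 0 < R ^ l := by positivity
    have h1 : R ^ l * L ≤ (R ^ l - 1) * L + ε * C := by
      refine le_of_tendsto_of_tendsto' (((tendsto_add_atTop_iff_nat l).2 hL).const_mul (R ^ l))
        ((hL.const_mul (R ^ l - 1)).add_const (ε * C)) fun n => ?_
      have hRn : 0 < R ^ n := by positivity
      have h2 : R ^ l * (a (n + l) / R ^ (n + l)) = a (n + l) / R ^ n := by
        rw [pow_add]; field_simp
      have h3 : (R ^ l - 1) * (a n / R ^ n) + ε * C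
          = ((R ^ l - 1) * a n + ε * (C * R ^ n)) / R ^ n := by
        field_simp
      rw [h2, h3]
      exact div_le_div_of_nonneg_right (hl n) hRn.le
    linarith
  have hzero : L = 0 := by
    refine le_antisymm ?_ hL0
    by_contra hcon
    push Not at hcon
    have hC : 0 < C := by
      have := hLε 1 one_pos
      linarith
    have := hLε (L / (2 * C)) (by positivity)
    have h2 : L / (2 * C) * C = L / 2 := by field_simp
    linarith
  rwa [hzero] at hL

end Growth

section SetFunction

variable {r : ℕ}

/-- The ball of radius `n` as a finset. -/
noncomputable def bF (r n : ℕ) : Finset (FG r) := (ball r n).toFinite.toFinset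

lemma mem_bF {n : ℕ} {g : FG r} : g ∈ bF r n ↔ wlen g ≤ n := by
  simp [bF, ball]

lemma bF_mono {m n : ℕ} (h : m ≤ n) : bF r m ⊆ bF r n := fun _ hg =>
  mem_bF.2 ((mem_bF.1 hg).trans h)

lemma gen_smul_bF_subset (p : Fin r × Bool) (n : ℕ) : gen p • bF r n ⊆ bF r (n + 1) := by
  intro g hg
  obtain ⟨g', hg', rfl⟩ := Finset.mem_smul_finset.1 hg
  have := wlen_gen_mul_le p g'
  have h2 := mem_bF.1 hg'
  rw [mem_bF, smul_eq_mul]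
  omega

/-- Monotone, submodular and left-invariant set functions on the finite subsets of `FG r`. -/
structure EntropyLike (h : Finset (FG r) → ℝ) : Prop where
  mono : ∀ E F, E ⊆ F → h E ≤ h F
  submodular : ∀ E F, h (E ∪ F) + h (E ∩ F) ≤ h E + h F
  smul : ∀ (g : FG r) E, h (g • E) = h E

namespace EntropyLike

variable {h : Finset (FG r) → ℝ}

lemma cond_le (hh : EntropyLike h) {E P : Finset (FG r)} (hEP : E ⊆ P) (Q : Finset (FG r)) :
    h (P ∪ Q) - h P ≤ h (E ∪ Q) - h E := by
  have h1 := hh.submodular P (E ∪ Q)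
  have h2 : P ∪ (E ∪ Q) = P ∪ Q := by
    rw [← Finset.union_assoc, Finset.union_eq_left.2 hEP]
  have h3 := hh.mono E (P ∩ (E ∪ Q)) (Finset.subset_inter hEP Finset.subset_union_left)
  rw [h2] at h1
  linarith

lemma cond_biUnion_le (hh : EntropyLike h) (E : Finset (FG r)) {ι : Type*} (t : Finset ι)
    (F : ι → Finset (FG r)) :
    h (E ∪ t.biUnion F) - h E ≤ ∑ i ∈ t, (h (E ∪ F i) - h E) := by
  classical
  induction t using Finset.induction_on with
  | empty => simp
  | insert i t hi ih =>
    rw [Finset.sum_insert hi, Finset.biUnion_insert]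
    have h1 := hh.cond_le (E := E) (P := E ∪ t.biUnion F) Finset.subset_union_left (F i)
    have h2 : E ∪ t.biUnion F ∪ F i = E ∪ (F i ∪ t.biUnion F) := by
      rw [Finset.union_assoc, Finset.union_comm (F i)]
    rw [h2] at h1
    linarith

end EntropyLike

/-- The entropy increment from the ball of radius `n` to its union with a translate by a
generator. -/
noncomputable def stepInc (h : Finset (FG r) → ℝ) (n : ℕ) (p : Fin r × Bool) : ℝ :=
  h (bF r n ∪ gen p • bF r n) - h (bF r n)

/-- The sum of `stepInc` over all generators and their inverses. -/
noncomputable def stepSum (h : Finset (FG r) → ℝ) (n : ℕ) : ℝ := ∑ p, stepInc h n p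

/-- The functional `F_G` evaluated on the ball of radius `n`. -/
noncomputable def fBall (h : Finset (FG r) → ℝ) (n : ℕ) : ℝ :=
  (1 - 2 * (r : ℝ)) * h (bF r n) + ∑ i : Fin r, h (FreeGroup.of i • bF r n ∪ bF r n)

namespace EntropyLike

variable {h : Finset (FG r) → ℝ}

lemma stepInc_nonneg (hh : EntropyLike h) (n : ℕ) (p : Fin r × Bool) : 0 ≤ stepInc h n p :=
  sub_nonneg.2 (hh.mono _ _ Finset.subset_union_left)

lemma stepSum_nonneg (hh : EntropyLike h) (n : ℕ) : 0 ≤ stepSum h n :=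
  Finset.sum_nonneg fun p _ => hh.stepInc_nonneg n p

lemma sub_le_stepSum (hh : EntropyLike h) (n : ℕ) :
    h (bF r (n + 1)) - h (bF r n) ≤ stepSum h n := by
  refine le_trans ?_ (hh.cond_biUnion_le (bF r n) Finset.univ fun p => gen p • bF r n)
  refine sub_le_sub_right (hh.mono _ _ fun g hg => ?_) _
  rw [mem_bF] at hg
  by_cases h1 : wlen g ≤ n
  · exact Finset.mem_union_left _ (mem_bF.2 h1)
  · obtain ⟨q, g', rfl, hq⟩ := exists_eq_gen_mul (g := g) (by
      rintro rfl
      simp [wlen] at h1)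
    refine Finset.mem_union_right _ (Finset.mem_biUnion.2 ⟨q, Finset.mem_univ _, ?_⟩)
    exact Finset.smul_mem_smul_finset (mem_bF.2 (by omega))

lemma stepInc_add_le (hh : EntropyLike h) (n : ℕ) (p : Fin r × Bool) :
    stepInc h (n + 1) p + stepInc h n (flip p) ≤ h (bF r (n + 1)) - h (bF r n) := by
  have h1 := hh.submodular ((gen p)⁻¹ • bF r (n + 1)) (bF r (n + 1))
  rw [hh.smul, ← hh.smul (gen p), Finset.smul_finset_union, smul_inv_smul] at h1
  have h2 : bF r n ∪ gen (flip p) • bF r n ⊆ (gen p)⁻¹ • bF r (n + 1) ∩ bF r (n + 1) := by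
    refine Finset.union_subset (Finset.subset_inter ?_ (bF_mono (Nat.le_succ n)))
      (Finset.subset_inter ?_ (gen_smul_bF_subset _ n))
    · rw [← Finset.smul_finset_subset_iff]
      exact gen_smul_bF_subset _ n
    · rw [gen_inv]
      exact Finset.smul_finset_subset_smul_finset (bF_mono (Nat.le_succ n))
  have h3 := hh.mono _ _ h2
  unfold stepInc
  linarith

lemma stepSum_add_le (hh : EntropyLike h) (n : ℕ) :
    stepSum h (n + 1) + stepSum h n ≤ 2 * r * (h (bF r (n + 1)) - h (bF r n)) := by
  have h1 : stepSum h n = ∑ p, stepInc h n (flip p) := by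
    refine (Equiv.sum_comp (Function.Involutive.toPerm (flip (r := r)) fun p => ?_) _).symm
    simp [flip]
  rw [h1, stepSum, ← Finset.sum_add_distrib]
  refine (Finset.sum_le_sum fun p _ => hh.stepInc_add_le n p).trans_eq ?_
  rw [Finset.sum_const, Finset.card_univ, Fintype.card_prod, Fintype.card_fin,
    Fintype.card_bool, nsmul_eq_mul]
  push_cast
  ring

lemma stepSum_eq (hh : EntropyLike h) (n : ℕ) :
    stepSum h n = 2 * fBall h n + (2 * r - 2) * h (bF r n) := by
  have h1 : ∀ i : Fin r, h (bF r n ∪ gen (i, true) • bF r n)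
      = h (FreeGroup.of i • bF r n ∪ bF r n) := by
    intro i
    rw [Finset.union_comm]
    rfl
  have h2 : ∀ i : Fin r, h (bF r n ∪ gen (i, false) • bF r n)
      = h (FreeGroup.of i • bF r n ∪ bF r n) := by
    intro i
    rw [← hh.smul (FreeGroup.of i), Finset.smul_finset_union, smul_smul,
      show gen (i, false) = (FreeGroup.of i)⁻¹ from rfl, mul_inv_cancel, one_smul]
  simp only [stepSum, stepInc, fBall, Fintype.sum_prod_type, Fintype.sum_bool, h1, h2,
    Finset.sum_add_distrib, Finset.sum_sub_distrib, Finset.sum_const, Finset.card_univ,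
    Fintype.card_prod, Fintype.card_fin, Fintype.card_bool, nsmul_eq_mul, Nat.cast_mul]
  push_cast
  ring

/-- If `F_G` is bounded below along balls and the increments are `o((2 r - 1) ^ n)`, then `h` is
bounded on balls. -/
lemma bounded_of_tendsto (hh : EntropyLike h) (hr : 2 ≤ r) {f : ℝ} (hf : ∀ n, f ≤ fBall h n)
    (hlim : Tendsto (fun n => stepSum h n / (2 * r - 1 : ℝ) ^ n) atTop (nhds 0)) :
    ∃ C, ∀ n, h (bF r n) ≤ C := by
  have hr' : (2 : ℝ) ≤ r := by exact_mod_cast hr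
  have hdef : ∀ n, 0 ≤ stepSum h n - (h (bF r (n + 1)) - h (bF r n)) := fun n =>
    sub_nonneg.2 (hh.sub_le_stepSum n)
  have hF : ∀ n, stepSum h n - (h (bF r (n + 1)) - h (bF r n)) ≤ fBall h n - fBall h (n + 1) := by
    intro n
    have h1 := hh.stepSum_add_le n
    have h2 := hh.stepSum_eq n
    have h3 := hh.stepSum_eq (n + 1)
    nlinarith
  have hd : ∀ n, (2 * r - 1 : ℝ) * stepSum h n - stepSum h (n + 1)
      = 2 * (fBall h n - fBall h (n + 1))
        + (2 * r - 2) * (stepSum h n - (h (bF r (n + 1)) - h (bF r n))) := by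
    intro n
    have h2 := hh.stepSum_eq n
    have h3 := hh.stepSum_eq (n + 1)
    linear_combination h2 - h3
  have hd1 : ∀ n, (2 * r - 1 : ℝ) * stepSum h n - stepSum h (n + 1)
      ≤ 2 * r * (fBall h n - fBall h (n + 1)) := by
    intro n
    rw [hd n]
    have := mul_le_mul_of_nonneg_left (hF n) (by linarith : (0 : ℝ) ≤ 2 * r - 2)
    linarith
  have hbound := sum_le_of_tendsto_zero (R := 2 * r - 1) (K := 2 * r * (fBall h 0 - f))
    (by linarith) hh.stepSum_nonneg (fun n => by
      have := hd n
      have h2 := mul_nonneg (by linarith : (0 : ℝ) ≤ 2 * r - 2) (hdef n)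
      have h3 := (hdef n).trans (hF n)
      linarith) (fun N => by
      refine (Finset.sum_le_sum fun n _ => hd1 n).trans ?_
      rw [← Finset.mul_sum, Finset.sum_range_sub']
      exact mul_le_mul_of_nonneg_left (by linarith [hf N]) (by positivity)) hlim
  refine ⟨h (bF r 0) + 2 * (2 * r * (fBall h 0 - f)) / (2 * r - 1 - 1), fun N => ?_⟩
  have h1 : h (bF r N) - h (bF r 0) ≤ ∑ n ∈ Finset.range N, stepSum h n := by
    rw [← Finset.sum_range_sub fun n => h (bF r n)]
    exact Finset.sum_le_sum fun n _ => hh.sub_le_stepSum n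
  have h2 : ∑ n ∈ Finset.range N, stepSum h n ≤ 2 * (2 * r * (fBall h 0 - f)) / (2 * r - 1 - 1) := by
    rw [le_div_iff₀ (by linarith), mul_comm]
    exact hbound N
  linarith

end EntropyLike

/-- The letters that can be prepended to `g` without cancellation. -/
def ext (g : FG r) : Finset (Fin r × Bool) :=
  Finset.univ.filter fun p => wlen (gen p * g) = wlen g + 1

lemma mem_ext {g : FG r} {p : Fin r × Bool} : p ∈ ext g ↔ wlen (gen p * g) = wlen g + 1 := by
  simp [ext]

lemma card_ext_le {g : FG r} (hg : g ≠ 1) : ((ext g).card : ℝ) ≤ 2 * r - 1 := by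
  obtain ⟨q, g', rfl, hq⟩ := exists_eq_gen_mul hg
  have h1 : ext (gen q * g') ⊆ Finset.univ.erase (flip q) := by
    intro p hp
    rw [mem_ext] at hp
    refine Finset.mem_erase.2 ⟨?_, Finset.mem_univ _⟩
    rintro rfl
    rw [← gen_inv, inv_mul_cancel_left] at hp
    omega
  have h2 := Finset.card_le_card h1
  rw [Finset.card_erase_of_mem (Finset.mem_univ _), Finset.card_univ, Fintype.card_prod,
    Fintype.card_fin, Fintype.card_bool] at h2
  have hr : 1 ≤ r := Fin.pos q.1
  have h3 : (ext (gen q * g')).card + 1 ≤ 2 * r := by omega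
  have h4 : (((ext (gen q * g')).card + 1 : ℕ) : ℝ) ≤ ((2 * r : ℕ) : ℝ) := by exact_mod_cast h3
  push_cast at h4
  linarith

/-- The operator summing a function over the successors of a group element. -/
def succSum (φ : FG r → ℝ) (g : FG r) : ℝ := ∑ p ∈ ext g, φ (gen p * g)

/-- The sphere of radius `n` as a finset. -/
noncomputable def sF (r n : ℕ) : Finset (FG r) := (bF r n).filter fun g => wlen g = n

lemma mem_sF {n : ℕ} {g : FG r} : g ∈ sF r n ↔ wlen g = n := by
  simp only [sF, Finset.mem_filter, mem_bF]
  omega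

lemma sum_sF_succ_le {φ : FG r → ℝ} (hφ : ∀ g, 0 ≤ φ g) (n : ℕ) :
    ∑ g ∈ sF r (n + 1), φ g ≤ ∑ g ∈ sF r n, succSum φ g := by
  unfold succSum
  rw [Finset.sum_sigma']
  rw [← Finset.sum_fiberwise_of_maps_to (t := sF r (n + 1)) 
    (g := fun x : (_ : FG r) × (Fin r × Bool) => gen x.2 * x.1)]
  · refine Finset.sum_le_sum fun g hg => ?_
    rw [mem_sF] at hg
    obtain ⟨q, g', rfl, hq⟩ := exists_eq_gen_mul (g := g) (by
      rintro rfl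
      simp [wlen] at hg)
    refine Finset.single_le_sum (f := fun x : (_ : FG r) × (Fin r × Bool) => φ (gen x.2 * x.1))
      (a := ⟨g', q⟩) (fun x _ => hφ _) ?_
    simp only [Finset.mem_filter, Finset.mem_sigma, mem_sF, mem_ext, and_true]
    omega
  · rintro ⟨g, p⟩ hx
    simp only [Finset.mem_sigma, mem_sF, mem_ext] at hx
    rw [mem_sF, hx.2, hx.1]

lemma succSum_nonneg {φ : FG r → ℝ} (hφ : ∀ g, 0 ≤ φ g) (g : FG r) : 0 ≤ succSum φ g :=
  Finset.sum_nonneg fun _ _ => hφ _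

lemma sum_sF_add_le {φ : FG r → ℝ} (hφ : ∀ g, 0 ≤ φ g) (n l : ℕ) :
    ∑ g ∈ sF r (n + l), φ g ≤ ∑ g ∈ sF r n, succSum^[l] φ g := by
  induction l generalizing φ with
  | zero => simp
  | succ l ih =>
    rw [Function.iterate_succ_apply]
    exact (sum_sF_succ_le hφ (n + l)).trans (ih (succSum_nonneg hφ))

/-- Functions that are nonnegative and decrease when a letter is prepended. -/
structure PrependAntitone (u : FG r → ℝ) : Prop where
  nonneg : ∀ g, 0 ≤ u g
  prepend_le : ∀ g p, g ≠ 1 → wlen (gen p * g) = wlen g + 1 → u (gen p * g) ≤ u g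

namespace PrependAntitone

variable {u : FG r → ℝ}

lemma gen_mul_ne_one {g : FG r} {p : Fin r × Bool} (hp : p ∈ ext g) : gen p * g ≠ 1 := by
  intro h
  rw [mem_ext, h] at hp
  simp [wlen] at hp

lemma iterate_le (hu : PrependAntitone u) (l : ℕ) {g : FG r} (hg : g ≠ 1) :
    succSum^[l] u g ≤ (2 * r - 1 : ℝ) ^ l * u g := by
  induction l generalizing g with
  | zero => simp
  | succ l ih =>
    rw [Function.iterate_succ_apply', succSum]
    have hR : (0 : ℝ) ≤ 2 * r - 1 := (Nat.cast_nonneg _).trans (card_ext_le hg)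
    calc ∑ p ∈ ext g, succSum^[l] u (gen p * g)
        ≤ ∑ p ∈ ext g, (2 * r - 1 : ℝ) ^ l * u g := Finset.sum_le_sum fun p hp =>
          (ih (gen_mul_ne_one hp)).trans (mul_le_mul_of_nonneg_left
            (hu.prepend_le g p hg (mem_ext.1 hp)) (by positivity))
      _ = (ext g).card * ((2 * r - 1 : ℝ) ^ l * u g) := by simp
      _ ≤ (2 * r - 1 : ℝ) * ((2 * r - 1 : ℝ) ^ l * u g) :=
          mul_le_mul_of_nonneg_right (card_ext_le hg) (mul_nonneg (by positivity) (hu.nonneg g))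
      _ = _ := by ring

lemma iterate_le_of_mul (hu : PrependAntitone u) (l : ℕ) {g w : FG r} (hg : g ≠ 1)
    (hw : wlen w = l) (hwg : wlen (w * g) = l + wlen g) :
    succSum^[l] u g ≤ ((2 * r - 1 : ℝ) ^ l - 1) * u g + u (w * g) := by
  induction l generalizing g w with
  | zero =>
    rw [wlen_eq_zero] at hw
    simp [hw]
  | succ l ih =>
    have hw1 : w ≠ 1 := by
      rintro rfl
      simp [wlen] at hw
    obtain ⟨w', q, rfl, hword⟩ := exists_eq_mul_gen hw1
    have hR : (0 : ℝ) ≤ 2 * r - 1 := (Nat.cast_nonneg _).trans (card_ext_le hg)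
    have hw' : wlen w' = l := by
      simp only [wlen, hword, List.length_append, List.length_singleton] at hw
      simpa [wlen] using hw
    have hq : q ∈ ext g := by
      rw [mem_ext]
      have h1 := wlen_gen_mul_le q g
      have h2 := wlen_mul_le w' (gen q * g)
      rw [← mul_assoc] at h2
      omega
    have hq' := mem_ext.1 hq
    have h1 := ih (gen_mul_ne_one hq) hw' (by rw [← mul_assoc, hwg, hq']; ring)
    have hpow : 0 ≤ (2 * r - 1 : ℝ) ^ l := by positivity
    have hnn := hu.nonneg (gen q * g)
    have h2 : succSum^[l] u (gen q * g) ≤ ((2 * r - 1 : ℝ) ^ l - 1) * u g + u (w' * gen q * g) := by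
      rw [← mul_assoc] at h1
      refine h1.trans (add_le_add_left (mul_le_mul_of_nonneg_left
        (hu.prepend_le g q hg hq') (sub_nonneg.2 (one_le_pow₀ ?_))) _)
      have hr1 : (1 : ℝ) ≤ r := by exact_mod_cast Fin.pos q.1
      linarith
    rw [Function.iterate_succ_apply', succSum, ← Finset.add_sum_erase _ _ hq]
    have h3 : ∑ p ∈ (ext g).erase q, succSum^[l] u (gen p * g)
        ≤ (2 * r - 1 - 1 : ℝ) * ((2 * r - 1 : ℝ) ^ l * u g) := by
      calc ∑ p ∈ (ext g).erase q, succSum^[l] u (gen p * g)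
          ≤ ∑ p ∈ (ext g).erase q, (2 * r - 1 : ℝ) ^ l * u g := Finset.sum_le_sum fun p hp => by
            have hp' := Finset.mem_of_mem_erase hp
            exact (hu.iterate_le l (gen_mul_ne_one hp')).trans (mul_le_mul_of_nonneg_left
              (hu.prepend_le g p hg (mem_ext.1 hp')) hpow)
        _ = ((ext g).erase q).card * ((2 * r - 1 : ℝ) ^ l * u g) := by simp
        _ ≤ _ := by
            refine mul_le_mul_of_nonneg_right ?_ (mul_nonneg hpow (hu.nonneg g))
            rw [Finset.cast_card_erase_of_mem hq]
            linarith [card_ext_le hg]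
    rw [pow_succ]
    linarith

/-- If `u` is small on a cylinder of arbitrarily small level, then its sphere sums are
`o((2 r - 1) ^ n)`. -/
lemma tendsto_sum_sF (hu : PrependAntitone u) (hr : 2 ≤ r)
    (hsmall : ∀ ε > 0, ∃ v : FG r, ∀ z, wlen (v * z) = wlen v + wlen z → v * z ≠ 1 →
      u (v * z) ≤ ε) :
    Tendsto (fun n => (∑ g ∈ sF r (n + 1), u g) / (2 * r - 1 : ℝ) ^ n) atTop (nhds 0) := by
  have hr' : (2 : ℝ) ≤ r := by exact_mod_cast hr
  have hne : ∀ {n : ℕ} {g : FG r}, g ∈ sF r (n + 1) → g ≠ 1 := by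
    rintro n g hg rfl
    rw [mem_sF] at hg
    simp [wlen] at hg
  have hone : PrependAntitone (fun _ : FG r => (1 : ℝ)) :=
    ⟨fun _ => zero_le_one, fun _ _ _ _ => le_rfl⟩
  have hgrow : ∀ {φ : FG r → ℝ}, PrependAntitone φ → ∀ n,
      ∑ g ∈ sF r (n + 1 + 1), φ g ≤ (2 * r - 1 : ℝ) * ∑ g ∈ sF r (n + 1), φ g := by
    intro φ hφ n
    refine (sum_sF_succ_le hφ.nonneg (n + 1)).trans ?_
    rw [Finset.mul_sum]
    refine Finset.sum_le_sum fun g hg => ?_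
    simpa using hφ.iterate_le 1 (hne hg)
  have hcard : ∀ n, ((sF r (n + 1)).card : ℝ) ≤ (sF r 1).card * (2 * r - 1 : ℝ) ^ n := by
    intro n
    induction n with
    | zero => simp
    | succ n ih =>
      have h1 := hgrow hone n
      simp only [Finset.sum_const, nsmul_eq_mul, mul_one] at h1
      refine h1.trans ((mul_le_mul_of_nonneg_left ih (by linarith)).trans_eq ?_)
      ring
  refine tendsto_div_pow_zero (C := (sF r 1).card) (by linarith)
    (fun n => Finset.sum_nonneg fun g _ => hu.nonneg g) (hgrow hu) fun ε hε => ?_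
  obtain ⟨v, hv⟩ := hsmall ε hε
  refine ⟨wlen v + 1, fun n => ?_⟩
  have h1 := sum_sF_add_le hu.nonneg (n + 1) (wlen v + 1)
  rw [show n + (wlen v + 1) + 1 = n + 1 + (wlen v + 1) by ring]
  refine h1.trans ?_
  calc ∑ g ∈ sF r (n + 1), succSum^[wlen v + 1] u g
      ≤ ∑ g ∈ sF r (n + 1), (((2 * r - 1 : ℝ) ^ (wlen v + 1) - 1) * u g + ε) := by
        refine Finset.sum_le_sum fun g hg => ?_
        obtain ⟨t, ht1, ht2, ht3⟩ := exists_gen_between hr v g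
        refine (hu.iterate_le_of_mul _ (hne hg) ht1 ht2).trans (add_le_add_right ?_ _)
        rw [mul_assoc] at ht2 ⊢
        refine hv _ (by rw [ht2, ht3]; ring) fun h => ?_
        rw [h] at ht2
        simp [wlen] at ht2
        omega
    _ = ((2 * r - 1 : ℝ) ^ (wlen v + 1) - 1) * ∑ g ∈ sF r (n + 1), u g
        + ε * (sF r (n + 1)).card := by
        rw [Finset.sum_add_distrib, ← Finset.mul_sum]
        simp [mul_comm]
    _ ≤ _ := add_le_add_right (mul_le_mul_of_nonneg_left (hcard n) hε.le) _

end PrependAntitone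

/-- The entropy increment obtained by adding `g` to the ball of radius `|g| - 1`. -/
noncomputable def pointInc (h : Finset (FG r) → ℝ) (g : FG r) : ℝ :=
  h (bF r (wlen g - 1) ∪ {g}) - h (bF r (wlen g - 1))

namespace EntropyLike

variable {h : Finset (FG r) → ℝ}

lemma prependAntitone_pointInc (hh : EntropyLike h) : PrependAntitone (pointInc h) where
  nonneg g := sub_nonneg.2 (hh.mono _ _ Finset.subset_union_left)
  prepend_le g p hg hp := by
    have hg' : wlen g ≠ 0 := fun h0 => hg (wlen_eq_zero.1 h0)
    have h1 := gen_smul_bF_subset p (wlen g - 1)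
    have h2 := hh.cond_le h1 {gen p * g}
    have h3 : gen p • bF r (wlen g - 1) ∪ {gen p * g} = gen p • (bF r (wlen g - 1) ∪ {g}) := by
      rw [Finset.smul_finset_union, Finset.smul_finset_singleton, smul_eq_mul]
    rw [h3, hh.smul, hh.smul, show wlen g - 1 + 1 = wlen (gen p * g) - 1 by omega] at h2
    exact h2

lemma stepSum_le (hh : EntropyLike h) (n : ℕ) :
    stepSum h n ≤ ∑ g ∈ sF r n, succSum (pointInc h) g := by
  have h1 : ∀ p, stepInc h n p
      ≤ ∑ g ∈ sF r n, if p ∈ ext g then pointInc h (gen p * g) else 0 := by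
    intro p
    rw [← Finset.sum_filter]
    set t := (sF r n).filter fun g => p ∈ ext g
    have h2 := hh.cond_biUnion_le (bF r n) t fun g => {gen p * g}
    refine (sub_le_sub_right (hh.mono _ _ (Finset.union_subset Finset.subset_union_left ?_))
      _).trans (h2.trans_eq (Finset.sum_congr rfl fun g hg => ?_))
    · intro x hx
      obtain ⟨g, hg, rfl⟩ := Finset.mem_smul_finset.1 hx
      rw [mem_bF] at hg
      rw [smul_eq_mul]
      by_cases hx : wlen (gen p * g) ≤ n
      · exact Finset.mem_union_left _ (mem_bF.2 hx)
      · have := wlen_gen_mul_le p g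
        refine Finset.mem_union_right _ (Finset.mem_biUnion.2 ⟨g, Finset.mem_filter.2
          ⟨mem_sF.2 (by omega), mem_ext.2 (by omega)⟩, Finset.mem_singleton_self _⟩)
    · obtain ⟨hg1, hg2⟩ := Finset.mem_filter.1 hg
      rw [mem_sF] at hg1
      rw [mem_ext] at hg2
      rw [pointInc, hg2, hg1, Nat.add_sub_cancel]
  refine (Finset.sum_le_sum fun p _ => h1 p).trans_eq ?_
  rw [Finset.sum_comm]
  refine Finset.sum_congr rfl fun g _ => ?_
  rw [succSum, ← Finset.sum_filter]
  simp

/-- If `F_G` is bounded below along balls and adding a point to a ball costs arbitrarily little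
along suitable cylinders, then `h` is bounded on balls. -/
lemma bounded_of_pointInc (hh : EntropyLike h) (hr : 2 ≤ r) {f : ℝ} (hf : ∀ n, f ≤ fBall h n)
    (hsmall : ∀ ε > 0, ∃ v : FG r, ∀ z, wlen (v * z) = wlen v + wlen z → v * z ≠ 1 →
      pointInc h (v * z) ≤ ε) :
    ∃ C, ∀ n, h (bF r n) ≤ C := by
  have hr' : (2 : ℝ) ≤ r := by exact_mod_cast hr
  refine hh.bounded_of_tendsto hr hf ?_
  rw [← tendsto_add_atTop_iff_nat 1]
  refine squeeze_zero (fun n => div_nonneg (hh.stepSum_nonneg _) (pow_nonneg (by linarith) _))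
    (fun n => ?_) (hh.prependAntitone_pointInc.tendsto_sum_sF hr hsmall)
  have hpos : (0 : ℝ) < 2 * r - 1 := by linarith
  rw [div_le_div_iff₀ (by positivity) (by positivity), pow_succ]
  have h1 : stepSum h (n + 1) ≤ (2 * r - 1 : ℝ) * ∑ g ∈ sF r (n + 1), pointInc h g := by
    refine (hh.stepSum_le (n + 1)).trans ?_
    rw [Finset.mul_sum]
    refine Finset.sum_le_sum fun g hg => ?_
    have hg1 : g ≠ 1 := by
      rintro rfl
      rw [mem_sF] at hg
      simp [wlen] at hg
    simpa using hh.prependAntitone_pointInc.iterate_le 1 hg1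
  have := mul_le_mul_of_nonneg_right h1 (by positivity : (0 : ℝ) ≤ (2 * r - 1 : ℝ) ^ n)
  linarith

end EntropyLike

end SetFunction

section EntropySetFunction

variable {r : ℕ} {X : Type*} [MeasurableSpace X] {μ : Measure X}
  {T : BorelAction (FG r) X} {a : X → ℕ}

lemma joinF_eq_iff {G I : Type*} [Group G] {T : BorelAction G X} {a : X → I} {F : Set G}
    {x y : X} :
    T.joinF F a x = T.joinF F a y ↔ ∀ g ∈ F, a (T.act g⁻¹ x) = a (T.act g⁻¹ y) := by
  simp [BorelAction.joinF, funext_iff]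

lemma measurable_joinF {G I : Type*} [Group G] {T : BorelAction G X} [MeasurableSpace I]
    {a : X → I} (ha : Measurable a) (F : Set G) : Measurable (T.joinF F a) :=
  measurable_pi_lambda _ fun _ => ha.comp (T.measurable_act _)

lemma Hpart_tr {T : BorelAction (FG r) X} (hT : T.Preserves μ) (ha : Measurable a) (g : FG r) :
    Hpart μ (T.tr g a) = Hpart μ a :=
  Hpart_comp_measurePreserving ha (hT g⁻¹)

variable [IsProbabilityMeasure μ]

lemma Hpart_joinF_lt_top (hT : T.Preserves μ) (ha : Measurable a) (hH : Hpart μ a < ⊤)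
    (E : Finset (FG r)) : Hpart μ (T.joinF (E : Set (FG r)) a) < ⊤ := by
  classical
  induction E using Finset.induction_on with
  | empty =>
    refine lt_of_le_of_lt (Hpart_le_of_determined (g := fun _ : X => ()) (s := univ)
      (measurable_joinF ha _) measurable_const (by simp) ?_) ?_
    · rintro x - y - -
      rw [joinF_eq_iff]
      simp
    · rw [Hpart_unit]
      exact ENNReal.zero_lt_top
  | insert g E hg ih =>
    have h1 : Measurable (T.tr g a) := ha.comp (T.measurable_act _)
    refine lt_of_le_of_lt ((Hpart_le_of_determined (s := univ)
      (g := fun x => (T.tr g a x, T.joinF (E : Set (FG r)) a x)) (measurable_joinF ha _)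
      (h1.prodMk (measurable_joinF ha _)) (by simp) ?_).trans
      (Hpart_prod_le h1 (measurable_joinF ha _))) ?_
    · rintro x - y - hxy
      rw [Prod.mk.injEq, joinF_eq_iff] at hxy
      rw [joinF_eq_iff]
      intro k hk
      rcases Finset.mem_insert.1 (Finset.mem_coe.1 hk) with rfl | hk
      · exact hxy.1
      · exact hxy.2 k hk
    · rw [Hpart_tr hT ha]
      exact ENNReal.add_lt_top.2 ⟨hH, ih⟩

/-- The Shannon entropy of `E · α` as a function of the finite set `E`. -/
noncomputable def hE (μ : Measure X) (T : BorelAction (FG r) X) (a : X → ℕ)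
    (E : Finset (FG r)) : ℝ := (Hpart μ (T.joinF (E : Set (FG r)) a)).toReal

lemma entropyLike_hE (hT : T.Preserves μ) (ha : Measurable a) (hH : Hpart μ a < ⊤) :
    EntropyLike (hE μ T a) where
  mono E F hEF := by
    refine ENNReal.toReal_mono (Hpart_joinF_lt_top hT ha hH F).ne ?_
    refine Hpart_le_of_determined (s := univ) (measurable_joinF ha _) (measurable_joinF ha _)
      (by simp) ?_
    rintro x - y - hxy
    rw [joinF_eq_iff] at hxy ⊢
    exact fun g hg => hxy g (hEF hg)
  submodular E F := by
    have hE' := measurable_joinF (T := T) ha (E : Set (FG r))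
    have hF' := measurable_joinF (T := T) ha (F : Set (FG r))
    have hI' := measurable_joinF (T := T) ha ((E ∩ F : Finset (FG r)) : Set (FG r))
    have hU' := measurable_joinF (T := T) ha ((E ∪ F : Finset (FG r)) : Set (FG r))
    have h1 := Hpart_submodular (μ := μ) hE' hF' hI'
    rw [Hpart_congr_of_determined (hE'.prodMk (hF'.prodMk hI')) hU' (by
        intro x y
        simp only [Prod.mk.injEq, joinF_eq_iff, Finset.mem_coe, Finset.mem_union,
          Finset.mem_inter]
        grind),
      Hpart_congr_of_determined (hE'.prodMk hI') hE' (by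
        intro x y
        simp only [Prod.mk.injEq, joinF_eq_iff, Finset.mem_coe, Finset.mem_inter]
        grind),
      Hpart_congr_of_determined (hF'.prodMk hI') hF' (by
        intro x y
        simp only [Prod.mk.injEq, joinF_eq_iff, Finset.mem_coe, Finset.mem_inter]
        grind)] at h1
    have hlt := Hpart_joinF_lt_top hT ha hH
    unfold hE
    rw [← ENNReal.toReal_add (hlt _).ne (hlt _).ne, ← ENNReal.toReal_add (hlt _).ne (hlt _).ne]
    exact ENNReal.toReal_mono (ENNReal.add_lt_top.2 ⟨hlt _, hlt _⟩).ne h1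
  smul g E := by
    have hE' := measurable_joinF (T := T) ha (E : Set (FG r))
    unfold hE
    rw [← Hpart_comp_measurePreserving hE' (hT g⁻¹)]
    congr 1
    refine Hpart_congr_of_determined (measurable_joinF ha _)
      (hE'.comp (T.measurable_act _)) fun x y => ?_
    simp only [joinF_eq_iff, Finset.mem_coe, ← T.act_mul, ← mul_inv_rev,
      Finset.mem_smul_finset, smul_eq_mul, forall_exists_index, and_imp,
      forall_apply_eq_imp_iff₂]

lemma fSeq_eq_fBall (ha : Measurable a) (n : ℕ) :
    fSeq μ T a n = fBall (hE μ T a) n := by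
  unfold fSeq FF fBall hE
  have hb := measurable_joinF (T := T) ha (ball r n)
  have h0 : ((bF r n : Finset (FG r)) : Set (FG r)) = ball r n := by
    ext g
    simp [mem_bF, ball]
  congr 1
  · congr 2
    refine Hpart_congr_of_determined hb (measurable_joinF ha _) fun x y => ?_
    rw [joinF_eq_iff, joinF_eq_iff, h0]
  · refine Finset.sum_congr rfl fun i _ => ?_
    congr 1
    refine Hpart_congr_of_determined ((hb.comp (T.measurable_act _)).prodMk hb)
      (measurable_joinF ha _) fun x y => ?_
    simp only [Prod.mk.injEq, BorelAction.tr, joinF_eq_iff, ← T.act_mul, ← mul_inv_rev,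
      Finset.mem_coe, Finset.mem_union, Finset.mem_smul_finset, smul_eq_mul, or_imp,
      forall_and, forall_exists_index, and_imp, forall_apply_eq_imp_iff₂, ← h0]

lemma exists_le_fBall (ha : Measurable a) (hf : fInv μ T a ≠ ⊥) :
    ∃ f : ℝ, ∀ n, f ≤ fBall (hE μ T a) n := by
  have hlt : ∀ n, fInv μ T a ≤ ((fSeq μ T a n : ℝ) : EReal) := fun n => iInf_le _ n
  refine ⟨(fInv μ T a).toReal, fun n => ?_⟩
  rw [← fSeq_eq_fBall ha, ← EReal.coe_le_coe_iff, EReal.coe_toReal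
    (ne_top_of_le_ne_top (EReal.coe_ne_top _) (hlt 0)) hf]
  exact hlt n

end EntropySetFunction

section Approximation

variable {X : Type*} [MeasurableSpace X] {μ : Measure X} [IsFiniteMeasure μ]

lemma exists_finset_measure_diff_lt {ι : Type*} [Countable ι] {f : ι → Set X}
    (hf : ∀ i, MeasurableSet (f i)) {ε : ℝ≥0∞} (hε : 0 < ε) :
    ∃ s : Finset ι, μ ((⋃ i, f i) \ ⋃ i ∈ s, f i) < ε := by
  classical
  obtain ⟨s, hs⟩ := exists_measure_iInter_lt (μ := μ)
    (f := fun s : Finset ι => (⋃ i, f i) \ ⋃ i ∈ s, f i)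
    (fun s => ((MeasurableSet.iUnion hf).diff
      (s.measurableSet_biUnion fun i _ => hf i)).nullMeasurableSet) hε
    ⟨∅, measure_ne_top _ _⟩ (by
      rw [eq_empty_iff_forall_notMem]
      intro x hx
      rw [mem_iInter] at hx
      obtain ⟨i, hi⟩ := mem_iUnion.1 (hx ∅).1
      exact (hx {i}).2 (by simpa using hi))
  refine ⟨s, lt_of_le_of_lt (measure_mono ?_) hs⟩
  refine subset_iInter₂ fun t ht => sdiff_subset_sdiff_right ?_
  exact biUnion_subset_biUnion_left ht

variable {r : ℕ} {T : BorelAction (FG r) X} {a : X → ℕ}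

/-- The σ-algebra of sets determined by the translates of `a` over the ball of radius `n`. -/
abbrev ballSA (T : BorelAction (FG r) X) (a : X → ℕ) (n : ℕ) : MeasurableSpace X :=
  MeasurableSpace.comap (T.joinF (ball r n) a) ⊤

lemma mem_iff_of_ballSA {n : ℕ} {A : Set X} (hA : MeasurableSet[ballSA T a n] A) {x y : X}
    (hxy : ∀ g : FG r, wlen g ≤ n → a (T.act g⁻¹ x) = a (T.act g⁻¹ y)) : x ∈ A ↔ y ∈ A := by
  obtain ⟨S, -, rfl⟩ := hA
  rw [mem_preimage, mem_preimage, joinF_eq_iff (F := ball r n).2 hxy]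

lemma ballSA_of_mem_iff {n : ℕ} {A : Set X}
    (hA : ∀ x y : X, (∀ g : FG r, wlen g ≤ n → a (T.act g⁻¹ x) = a (T.act g⁻¹ y)) → x ∈ A → y ∈ A) :
    MeasurableSet[ballSA T a n] A := by
  refine ⟨T.joinF (ball r n) a '' A, trivial, ?_⟩
  ext x
  constructor
  · rintro ⟨y, hy, hyx⟩
    exact hA y x (joinF_eq_iff.1 hyx) hy
  · exact fun hx => ⟨x, hx, rfl⟩

lemma ballSA_mono {m n : ℕ} (hmn : m ≤ n) : ballSA T a m ≤ ballSA T a n := fun _ hA =>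
  ballSA_of_mem_iff fun _ _ hxy hx =>
    (mem_iff_of_ballSA hA fun g hg => hxy g (hg.trans hmn)).1 hx

lemma exists_approx (ha : Measurable a) (hgen : T.Generating a μ) {B : Set X}
    (hB : MeasurableSet B) {η : ℝ≥0∞} (hη : 0 < η) :
    ∃ n A, MeasurableSet[ballSA T a n] A ∧ μ (A ∆ B) ≤ η := by
  let P : Set X → Prop := fun B => ∀ η > (0 : ℝ≥0∞),
    ∃ n A, MeasurableSet[ballSA T a n] A ∧ μ (A ∆ B) ≤ η
  have hunion : ∀ B B', P B → P B' → P (B ∪ B') := by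
    intro B B' hB hB' η hη
    obtain ⟨n, A, hA, hAB⟩ := hB _ (ENNReal.half_pos hη.ne')
    obtain ⟨n', A', hA', hAB'⟩ := hB' _ (ENNReal.half_pos hη.ne')
    refine ⟨max n n', A ∪ A', (ballSA_mono (le_max_left n n') _ hA).union
      (ballSA_mono (le_max_right n n') _ hA'), ?_⟩
    refine (measure_mono (t := A ∆ B ∪ A' ∆ B') ?_).trans ((measure_union_le _ _).trans
      ((add_le_add hAB hAB').trans_eq (ENNReal.add_halves η)))
    exact union_symmDiff_union_subset
  have hempty : P ∅ := fun η _ => ⟨0, ∅, @MeasurableSet.empty _ (ballSA T a 0), by simp⟩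
  have hcompl : ∀ B, P B → P Bᶜ := by
    intro B hB η hη
    obtain ⟨n, A, hA, hAB⟩ := hB η hη
    exact ⟨n, Aᶜ, hA.compl, by rwa [compl_symmDiff_compl]⟩
  have hiUnion : ∀ f : ℕ → Set X, (∀ i, MeasurableSet (f i)) → (∀ i, P (f i)) →
      P (⋃ i, f i) := by
    intro f hfm hf η hη
    obtain ⟨s, hs⟩ := exists_finset_measure_diff_lt (μ := μ) hfm (ENNReal.half_pos hη.ne')
    have hfin : P (⋃ i ∈ s, f i) := by
      clear hs
      induction s using Finset.induction_on with
      | empty => simpa using hempty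
      | insert i s hi ih =>
        rw [Finset.set_biUnion_insert]
        exact hunion _ _ (hf i) ih
    obtain ⟨n, A, hA, hAB⟩ := hfin _ (ENNReal.half_pos hη.ne')
    refine ⟨n, A, hA, (measure_symmDiff_le A (⋃ i ∈ s, f i) _).trans ?_⟩
    refine (add_le_add hAB ?_).trans_eq (ENNReal.add_halves η)
    rw [symmDiff_of_le (show ⋃ i ∈ s, f i ⊆ ⋃ i, f i from iUnion₂_subset_iUnion _ _)]
    exact hs.le
  have hbase : ∀ (g : FG r) (S : Set ℕ), MeasurableSet (T.tr g a ⁻¹' S) ∧ P (T.tr g a ⁻¹' S) := by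
    intro g S
    refine ⟨(ha.comp (T.measurable_act _)) S.to_countable.measurableSet, fun η _ =>
      ⟨wlen g, T.tr g a ⁻¹' S, ballSA_of_mem_iff fun x y hxy hx => ?_, by simp⟩⟩
    rwa [mem_preimage, BorelAction.tr, ← hxy g le_rfl]
  have hle : T.partSA univ a ≤
      { MeasurableSet' := fun B => MeasurableSet B ∧ P B
        measurableSet_empty := ⟨MeasurableSet.empty, hempty⟩
        measurableSet_compl := fun B hB => ⟨hB.1.compl, hcompl B hB.2⟩
        measurableSet_iUnion := fun f hf =>
          ⟨MeasurableSet.iUnion fun i => (hf i).1, hiUnion f (fun i => (hf i).1)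
            fun i => (hf i).2⟩ } := by
    refine iSup₂_le fun g _ => ?_
    rintro _ ⟨S, -, rfl⟩
    exact hbase g S
  obtain ⟨B', hB', hBB'⟩ := hgen B hB
  obtain ⟨n, A, hA, hAB⟩ := (hle _ hB').2 η hη
  refine ⟨n, A, hA, (measure_symmDiff_le A B' B).trans ?_⟩
  rw [symmDiff_comm B' B, hBB', add_zero]
  exact hAB

end Approximation

section Stabilizers

variable {r : ℕ} {X : Type*} [MeasurableSpace X] {μ : Measure X}
  {T : BorelAction (FG r) X}

/-- The set of fixed points of a group element. -/
def Fx (T : BorelAction (FG r) X) (c : FG r) : Set X := {x | T.act c x = x}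

/-- The set of points fixed by some element whose reduced word begins with `t`. -/
def fixHead (T : BorelAction (FG r) X) (t : Fin r × Bool) : Set X :=
  ⋃ c : {c : FG r // c.toWord.head? = some t}, Fx T c

lemma act_inv_act (g : FG r) (x : X) : T.act g⁻¹ (T.act g x) = x := by
  rw [← T.act_mul, inv_mul_cancel, T.act_one]

lemma act_act_inv (g : FG r) (x : X) : T.act g (T.act g⁻¹ x) = x := by
  rw [← T.act_mul, mul_inv_cancel, T.act_one]

lemma preimage_Fx (g c : FG r) : T.act g⁻¹ ⁻¹' Fx T c = Fx T (g * c * g⁻¹) := by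
  ext x
  change T.act c (T.act g⁻¹ x) = T.act g⁻¹ x ↔ T.act (g * c * g⁻¹) x = x
  rw [T.act_mul, T.act_mul]
  constructor
  · intro h
    rw [h, act_act_inv]
  · intro h
    rw [← act_inv_act (T := T) g (T.act c (T.act g⁻¹ x)), h]

lemma preimage_fixHead_subset {s t : Fin r × Bool} (hst : t ≠ flip s) :
    T.act (gen s)⁻¹ ⁻¹' fixHead T t ⊆ fixHead T s := by
  rw [fixHead, preimage_iUnion]
  refine iUnion_subset fun c => ?_
  rw [preimage_Fx]
  exact subset_iUnion (fun c : {c : FG r // c.toWord.head? = some s} => Fx T c)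
    ⟨_, head_conj c.2 hst⟩

variable [StandardBorelSpace X]

lemma measurableSet_Fx (c : FG r) : MeasurableSet (Fx T c) :=
  measurableSet_eq_fun (T.measurable_act c) measurable_id

lemma measurableSet_fixHead (t : Fin r × Bool) : MeasurableSet (fixHead T t) :=
  MeasurableSet.iUnion fun c => measurableSet_Fx c.1

lemma measure_fixHead_eq_one [IsProbabilityMeasure μ] (hr : 2 ≤ r) (hT : T.Preserves μ)
    (herg : T.IsErgodic μ) (hfree : ¬ T.EssentiallyFree μ) (t : Fin r × Bool) :
    μ (fixHead T t) = 1 := by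
  have hthird : ∀ s t : Fin r × Bool, ∃ u, t ≠ flip u ∧ u ≠ flip s := by
    intro s t
    by_cases h : t = flip s
    · have : Nontrivial (Fin r) := Fin.nontrivial_iff_two_le.2 hr
      obtain ⟨j, hj⟩ := exists_ne s.1
      refine ⟨(j, true), ?_, ?_⟩
      · rintro h2
        rw [h] at h2
        exact hj (congrArg Prod.fst h2).symm
      · rintro h2
        exact hj (congrArg Prod.fst h2)
    · refine ⟨t, fun h2 => ?_, h⟩
      have := congrArg Prod.snd h2
      simp [flip] at this
  have hstep : ∀ s t, t ≠ flip s → μ (fixHead T t) ≤ μ (fixHead T s) := by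
    intro s t hst
    rw [← (hT (gen s)⁻¹).measure_preimage (measurableSet_fixHead t).nullMeasurableSet]
    exact measure_mono (preimage_fixHead_subset hst)
  have hle : ∀ s t, μ (fixHead T t) ≤ μ (fixHead T s) := by
    intro s t
    obtain ⟨u, h1, h2⟩ := hthird s t
    exact (hstep u t h1).trans (hstep s u h2)
  have hpre : ∀ s t, t ≠ flip s → T.act (gen s)⁻¹ ⁻¹' fixHead T t =ᵐ[μ] fixHead T s := by
    intro s t hst
    refine ae_eq_of_subset_of_measure_ge (preimage_fixHead_subset hst) ?_
      ((measurableSet_fixHead t).preimage (T.measurable_act _)).nullMeasurableSet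
      (measure_ne_top _ _)
    rw [(hT (gen s)⁻¹).measure_preimage (measurableSet_fixHead t).nullMeasurableSet]
    exact hle t s
  have hself : ∀ s : Fin r × Bool, s ≠ flip s := by
    intro s h
    have := congrArg Prod.snd h
    simp [flip] at this
  have heq1 : ∀ s t, t ≠ flip s → fixHead T t =ᵐ[μ] fixHead T s := by
    intro s t hst
    have h1 := (hpre s t hst).trans (hpre s s (hself s)).symm
    have h2 := (hT (gen s)).quasiMeasurePreserving.preimage_ae_eq h1
    rw [← preimage_comp, ← preimage_comp] at h2
    have h3 : T.act (gen s)⁻¹ ∘ T.act (gen s) = id := funext fun x => act_inv_act _ x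
    rwa [h3, preimage_id, preimage_id] at h2
  have heq : ∀ s t, fixHead T t =ᵐ[μ] fixHead T s := by
    intro s t
    obtain ⟨u, h1, h2⟩ := hthird s t
    exact (heq1 u t h1).trans (heq1 s u h2)
  set D : Set X := {x | ∀ g : FG r, g ≠ 1 → T.act g x ≠ x}ᶜ with hD
  have hDU : D = ⋃ t, fixHead T t := by
    ext x
    simp only [hD, mem_compl_iff, mem_ofPred_eq, not_forall, not_not, fixHead, mem_iUnion,
      Subtype.exists, Fx]
    constructor
    · rintro ⟨g, hg, hgx⟩
      obtain ⟨q, l, hl⟩ : ∃ q l, g.toWord = q :: l :=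
        List.exists_cons_of_ne_nil fun h => hg (FreeGroup.toWord_eq_nil_iff.1 h)
      exact ⟨q, g, by simp [hl], hgx⟩
    · rintro ⟨t, c, hc, hcx⟩
      refine ⟨c, ?_, hcx⟩
      rintro rfl
      simp at hc
  have hDm : MeasurableSet D := hDU ▸ MeasurableSet.iUnion measurableSet_fixHead
  have hinv : ∀ g : FG r, T.smulSet g D = D := by
    have hsub : ∀ g : FG r, ∀ x, T.act g⁻¹ x ∈ D → x ∈ D := by
      intro g x hx
      simp only [hD, mem_compl_iff, mem_ofPred_eq, not_forall, not_not] at hx ⊢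
      obtain ⟨c, hc, hcx⟩ := hx
      refine ⟨g * c * g⁻¹, by simpa using hc, ?_⟩
      have : x ∈ Fx T (g * c * g⁻¹) := by
        rw [← preimage_Fx]
        exact hcx
      exact this
    intro g
    ext x
    refine ⟨hsub g x, fun hx => hsub g⁻¹ _ ?_⟩
    rw [inv_inv]
    change T.act g (T.act g⁻¹ x) ∈ D
    rwa [act_act_inv]
  have hD1 : μ D = 1 := by
    refine (herg D hDm fun g => by simp [hinv]).resolve_left fun h0 => hfree ?_
    rw [BorelAction.EssentiallyFree, ← compl_compl {x | ∀ g : FG r, g ≠ 1 → T.act g x ≠ x}]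
    exact (prob_compl_eq_one_iff hDm).2 h0
  have hDt : D =ᵐ[μ] fixHead T t := by
    rw [hDU]
    refine (Filter.EventuallyEq.countable_iUnion fun s => heq t s).trans ?_
    have : Nonempty (Fin r × Bool) := ⟨t⟩
    rw [iUnion_const]
    exact EventuallyEq.rfl
  rw [← measure_congr hDt, hD1]

end Stabilizers

section Prediction

variable {r : ℕ} {X : Type*} [MeasurableSpace X] {μ : Measure X} {T : BorelAction (FG r) X}

/-- Every element of `K` shortens every reduced extension of `v`. -/
def Shortens (v : FG r) (K : Finset (FG r)) : Prop :=
  ∀ e ∈ K, ∀ z, wlen (v * z) = wlen v + wlen z → wlen (e⁻¹ * (v * z)) < wlen (v * z)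

lemma Shortens.mul_right {v c : FG r} {K : Finset (FG r)} (hK : Shortens v K)
    (hc : wlen (v * c) = wlen v + wlen c) : Shortens (v * c) K := by
  intro e he z hz
  rw [mul_assoc] at hz ⊢
  refine hK e he _ ?_
  have h1 := wlen_mul_le v (c * z)
  have h2 := wlen_mul_le c z
  omega

lemma Shortens.insert_conj {v c : FG r} {K : Finset (FG r)} (hK : Shortens v K)
    (hc1 : c ≠ 1) (hc : wlen (v * c) = wlen v + wlen c) :
    Shortens (v * c) (insert (v * c * v⁻¹) K) := by
  intro e he z hz
  rcases Finset.mem_insert.1 he with rfl | he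
  · have h0 : wlen c ≠ 0 := fun h => hc1 (wlen_eq_zero.1 h)
    have h1 : (v * c * v⁻¹)⁻¹ * (v * c * z) = v * z := by group
    have h2 := wlen_mul_le v z
    rw [h1]
    omega
  · exact hK.mul_right hc e he z hz

lemma exists_shortens_long (hr : 1 ≤ r) {v : FG r} {K : Finset (FG r)} (hK : Shortens v K)
    (m : ℕ) : ∃ v', Shortens v' K ∧ m ≤ wlen v' := by
  induction m with
  | zero => exact ⟨v, hK, Nat.zero_le _⟩
  | succ m ih =>
    obtain ⟨v', hv', hm⟩ := ih
    obtain ⟨t, ht⟩ := exists_head_adj hr v'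
    have h1 := ht (gen t) (by rw [toWord_gen]; rfl)
    refine ⟨v' * gen t, hv'.mul_right h1, ?_⟩
    rw [h1, wlen_gen]
    omega

variable [IsProbabilityMeasure μ]

/-- A partition that agrees off a small set with one determined by `B` has small conditional
entropy given `B`. -/
lemma exists_Hpart_pair_le {a : X → ℕ} (ha : Measurable a) (hH : Hpart μ a < ⊤) {ε : ℝ}
    (hε : 0 < ε) :
    ∃ δ > (0 : ℝ≥0∞), ∀ {J : Type} [Countable J] [MeasurableSpace J] [MeasurableSingletonClass J]
      (q p : X → ℕ) (B : X → J), Measurable q → Measurable B →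
      (∀ i, μ (q ⁻¹' {i}) = μ (a ⁻¹' {i})) → (∀ x y, B x = B y → p x = p y) →
      μ {x | q x ≠ p x} ≤ δ →
      Hpart μ (fun x => (q x, B x)) ≤ ENNReal.ofReal ε + Hpart μ B := by
  classical
  obtain ⟨δ, hδ, h⟩ := exists_Hpart_restrict_lt ha hH hε
  refine ⟨δ, hδ, fun {J} _ _ _ q p B hq hB hqa hp hD => ?_⟩
  have hpm : Measurable p := by
    have h1 : p = Function.extend B p 0 ∘ B :=
      funext fun x => (Function.FactorsThrough.extend_apply (fun x y => hp x y) 0 x).symm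
    rw [h1]
    exact (measurable_of_countable _).comp hB
  have hDm : MeasurableSet {x | q x ≠ p x} := (measurableSet_eq_fun hq hpm).compl
  set q' : X → ℕ := fun x => if q x ≠ p x then q x + 1 else 0 with hq'
  have hq'm : Measurable q' := Measurable.ite hDm (hq.add_const 1) measurable_const
  have h1 := h q {x | q x ≠ p x} hDm hq hqa hD q' (fun x hx => if_pos hx) (fun x hx => if_neg hx)
  refine (Hpart_le_of_determined (s := univ) (g := fun x => (q' x, B x)) (hq.prodMk hB)
    (hq'm.prodMk hB) (by simp) ?_).trans ((Hpart_prod_le hq'm hB).trans (add_le_add_left h1 _))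
  rintro x - y - hxy
  rw [Prod.mk.injEq] at hxy ⊢
  refine ⟨?_, hxy.2⟩
  have h2 := hxy.1
  have h3 := hp x y hxy.2
  simp only [hq'] at h2
  split_ifs at h2 <;> omega

variable [StandardBorelSpace X]

/-- If every `fixHead T t` has full measure, then finitely many fixed-point sets of elements
shortening the reduced extensions of a single `v` cover almost all of the space. -/
lemma exists_shortens_cover (hr : 1 ≤ r) (hT : T.Preserves μ)
    (hfull : ∀ t, μ (fixHead T t) = 1) {η : ℝ} (hη : 0 < η) :
    ∃ v K, Shortens v K ∧ μ.real (⋃ e ∈ K, Fx T e)ᶜ ≤ η := by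
  classical
  have hU : ∀ t, ∃ s : Finset {c : FG r // c.toWord.head? = some t},
      μ.real (⋃ c ∈ s, Fx T c)ᶜ ≤ η / 2 := by
    intro t
    obtain ⟨s, hs⟩ := exists_finset_measure_diff_lt (μ := μ)
      (f := fun c : {c : FG r // c.toWord.head? = some t} => Fx T c)
      (fun c => measurableSet_Fx c.1) (ε := ENNReal.ofReal (η / 2)) (by simpa using hη)
    refine ⟨s, ENNReal.toReal_le_of_le_ofReal (by positivity) ?_⟩
    refine le_trans (measure_mono_ae ?_) hs.le
    have h1 : ∀ᵐ x ∂μ, x ∈ fixHead T t :=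
      mem_ae_iff.2 ((prob_compl_eq_zero_iff (measurableSet_fixHead t)).2 (hfull t))
    filter_upwards [h1] with x hx hx2
    exact ⟨hx, hx2⟩
  choose U hU using hU
  obtain ⟨M, hM⟩ : ∃ M : ℕ, ∀ t, (U t).card ≤ M :=
    ⟨∑ t, (U t).card, fun t => Finset.single_le_sum (f := fun t => (U t).card)
      (fun _ _ => Nat.zero_le _) (Finset.mem_univ t)⟩
  by_contra hcon
  push Not at hcon
  set δ : ℝ := η / 2 / (M + 1) with hδ
  have hδ0 : 0 < δ := by positivity
  have hdec : ∀ k : ℕ, ∃ v K, Shortens v K ∧ μ.real (⋃ e ∈ K, Fx T e)ᶜ ≤ 1 - k * δ := by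
    intro k
    induction k with
    | zero => exact ⟨1, ∅, by simp [Shortens], by simp⟩
    | succ k ih =>
      obtain ⟨v, K, hK, hk⟩ := ih
      set N : Set X := (⋃ e ∈ K, Fx T e)ᶜ with hN
      have hNη : η < μ.real N := hcon v K hK
      obtain ⟨t, ht⟩ := exists_head_adj hr v
      have h1 : μ.real (⋃ c ∈ U t, Fx T (v * c * v⁻¹))ᶜ ≤ η / 2 := by
        have h2 : (⋃ c ∈ U t, Fx T (v * c * v⁻¹))ᶜ = T.act v⁻¹ ⁻¹' (⋃ c ∈ U t, Fx T c)ᶜ := by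
          simp only [preimage_compl, preimage_iUnion, preimage_Fx]
        rw [h2, measureReal_def, (hT v⁻¹).measure_preimage
          ((U t).measurableSet_biUnion fun c _ => measurableSet_Fx c.1).compl.nullMeasurableSet]
        exact hU t
      have h2 : η / 2 < ∑ c ∈ U t, μ.real (N ∩ Fx T (v * c * v⁻¹)) := by
        have h3 : N ⊆ (⋃ c ∈ U t, N ∩ Fx T (v * c * v⁻¹)) ∪ (⋃ c ∈ U t, Fx T (v * c * v⁻¹))ᶜ := by
          intro x hx
          by_cases hx2 : x ∈ ⋃ c ∈ U t, Fx T (v * c * v⁻¹)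
          · left
            simp only [mem_iUnion, mem_inter_iff] at hx2 ⊢
            obtain ⟨c, hc, hcx⟩ := hx2
            exact ⟨c, hc, hx, hcx⟩
          · exact Or.inr hx2
        have h4 := (measureReal_mono (μ := μ) h3).trans (measureReal_union_le _ _)
        have h5 := measureReal_biUnion_finset_le (μ := μ) (U t)
          fun c => N ∩ Fx T (v * c * v⁻¹)
        linarith
      obtain ⟨c, hc, hcδ⟩ : ∃ c ∈ U t, δ ≤ μ.real (N ∩ Fx T (v * c * v⁻¹)) := by
        by_contra hno
        push Not at hno
        have h3 := Finset.sum_le_sum fun c hc => (hno c hc).le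
        rw [Finset.sum_const, nsmul_eq_mul] at h3
        have h4 : ((U t).card : ℝ) * δ ≤ (M + 1) * δ :=
          mul_le_mul_of_nonneg_right (by exact_mod_cast (hM t).trans (Nat.le_succ M)) hδ0.le
        have h5 : (M + 1) * δ = η / 2 := by rw [hδ]; field_simp
        linarith
      have hc1 : (c : FG r) ≠ 1 := by
        intro h
        have := c.2
        rw [h] at this
        simp at this
      refine ⟨v * c, _, hK.insert_conj hc1 (ht c c.2), ?_⟩
      have h3 : (⋃ e ∈ insert (v * (c : FG r) * v⁻¹) K, Fx T e)ᶜ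
          = N \ (N ∩ Fx T (v * c * v⁻¹)) := by
        rw [Finset.set_biUnion_insert, compl_union, sdiff_self_inter, inter_comm, ← hN]
        rfl
      have hNm : MeasurableSet N :=
        (K.measurableSet_biUnion fun e _ => measurableSet_Fx e).compl
      rw [h3, measureReal_sdiff inter_subset_left (hNm.inter (measurableSet_Fx _))]
      push_cast
      linarith
  obtain ⟨k, hk⟩ := exists_nat_gt (1 / δ)
  obtain ⟨v, K, -, h⟩ := hdec k
  rw [div_lt_iff₀ hδ0] at hk
  have := measureReal_nonneg (μ := μ) (s := (⋃ e ∈ K, Fx T e)ᶜ)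
  linarith

lemma exists_pointInc_le (hr : 1 ≤ r) (hT : T.Preserves μ)
    (hfull : ∀ t, μ (fixHead T t) = 1) {a : X → ℕ} (ha : Measurable a) (hH : Hpart μ a < ⊤)
    (hgen : T.Generating a μ) {ε : ℝ} (hε : 0 < ε) :
    ∃ v : FG r, ∀ z, wlen (v * z) = wlen v + wlen z → v * z ≠ 1 →
      pointInc (hE μ T a) (v * z) ≤ ε := by
  classical
  obtain ⟨δ, hδ, hpair⟩ := exists_Hpart_pair_le ha hH hε
  obtain ⟨δ', hδ', hδδ⟩ : ∃ δ' : ℝ, 0 < δ' ∧ ENNReal.ofReal δ' ≤ δ / 2 := by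
    obtain ⟨δ', h1, h2⟩ := ENNReal.lt_iff_exists_nnreal_btwn.1 (ENNReal.half_pos hδ.ne')
    exact ⟨δ', by exact_mod_cast h1, by simpa using h2.le⟩
  obtain ⟨v₀, K, hK₀, hcover⟩ := exists_shortens_cover hr hT hfull hδ'
  have hη : 0 < δ / 2 / (K.card + 1) :=
    ENNReal.div_pos (ENNReal.half_pos hδ.ne').ne' (by finiteness)
  choose n A hA hAF using fun e => exists_approx ha hgen (measurableSet_Fx (T := T) e) hη
  obtain ⟨m, hm⟩ : ∃ m : ℕ, ∀ e ∈ K, n e ≤ m :=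
    ⟨∑ e ∈ K, n e, fun e he => Finset.single_le_sum (f := n) (fun _ _ => Nat.zero_le _) he⟩
  obtain ⟨v, hK, hv⟩ := exists_shortens_long hr hK₀ (m + 1)
  refine ⟨v, fun z hz _ => ?_⟩
  set g := v * z with hg
  set L := wlen g - 1 with hL
  have hmL : m ≤ L := by omega
  have hKL : ∀ e ∈ K, wlen (e⁻¹ * g) ≤ L := fun e he => by
    have : wlen (e⁻¹ * g) < wlen g := hK e he z hz
    omega
  let sel : X → Finset (FG r) := fun x => K.filter fun e => x ∈ A e
  let p : X → ℕ := fun x =>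
    if h : (sel x).Nonempty then a (T.act (h.choose⁻¹ * g)⁻¹ x) else 0
  have hB := measurable_joinF (T := T) ha ((bF r L : Finset (FG r)) : Set (FG r))
  have hlt := Hpart_joinF_lt_top hT ha hH
  have hpB : ∀ x y, T.joinF ((bF r L : Finset (FG r)) : Set (FG r)) a x
      = T.joinF ((bF r L : Finset (FG r)) : Set (FG r)) a y → p x = p y := by
    intro x y hxy
    rw [joinF_eq_iff] at hxy
    have hsel : sel x = sel y := Finset.filter_congr fun e he =>
      mem_iff_of_ballSA (hA e) fun k hk => hxy k (mem_bF.2 (hk.trans ((hm e he).trans hmL)))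
    simp only [p, hsel]
    split_ifs with h
    · exact hxy _ (mem_bF.2 (hKL _ (Finset.mem_filter.1 h.choose_spec).1))
    · rfl
  have hD : μ {x | T.tr g a x ≠ p x} ≤ δ := by
    have hsub : {x | T.tr g a x ≠ p x}
        ⊆ (⋃ e ∈ K, Fx T e)ᶜ ∪ ⋃ e ∈ K, A e ∆ Fx T e := by
      intro x hx
      by_contra hcon
      rw [mem_union, mem_compl_iff, not_or, not_not] at hcon
      simp only [mem_iUnion, not_exists, exists_prop] at hcon
      obtain ⟨⟨e₀, he₀, hxe₀⟩, hsymm⟩ := hcon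
      have hiff : ∀ e ∈ K, x ∈ A e ↔ x ∈ Fx T e := fun e he => by
        have := hsymm e
        rw [mem_symmDiff] at this
        tauto
      have hne : (sel x).Nonempty := ⟨e₀, Finset.mem_filter.2 ⟨he₀, (hiff e₀ he₀).2 hxe₀⟩⟩
      obtain ⟨he, hxA⟩ := Finset.mem_filter.1 hne.choose_spec
      have hfix : T.act hne.choose x = x := (hiff _ he).1 hxA
      refine hx ?_
      simp only [p, dif_pos hne, BorelAction.tr, mul_inv_rev, inv_inv, T.act_mul, hfix]
    refine (measure_mono hsub).trans ((measure_union_le _ _).trans ?_)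
    have h1 : μ (⋃ e ∈ K, Fx T e)ᶜ ≤ δ / 2 :=
      (ENNReal.le_ofReal_iff_toReal_le (measure_ne_top _ _) hδ'.le).2 hcover |>.trans hδδ
    have h2 : μ (⋃ e ∈ K, A e ∆ Fx T e) ≤ δ / 2 := by
      refine (measure_biUnion_finset_le _ _).trans ((Finset.sum_le_sum fun e _ => hAF e).trans ?_)
      rw [Finset.sum_const, nsmul_eq_mul]
      refine (mul_le_mul_left (le_self_add (b := 1)) _).trans ?_
      exact ENNReal.mul_div_le
    exact (add_le_add h1 h2).trans_eq (ENNReal.add_halves δ)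
  have hq : Measurable (T.tr g a) := ha.comp (T.measurable_act _)
  have hmain := hpair (T.tr g a) p (T.joinF ((bF r L : Finset (FG r)) : Set (FG r)) a) hq hB
    (fun i => (hT g⁻¹).measure_preimage (ha (measurableSet_singleton i)).nullMeasurableSet) hpB hD
  have hjoin : Hpart μ (T.joinF ((bF r L ∪ {g} : Finset (FG r)) : Set (FG r)) a)
      ≤ Hpart μ (fun x => (T.tr g a x, T.joinF ((bF r L : Finset (FG r)) : Set (FG r)) a x)) := by
    refine Hpart_le_of_determined (s := univ) (measurable_joinF ha _) (hq.prodMk hB) (by simp) ?_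
    rintro x - y - hxy
    rw [Prod.mk.injEq, joinF_eq_iff] at hxy
    rw [joinF_eq_iff]
    intro k hk
    rcases Finset.mem_union.1 (Finset.mem_coe.1 hk) with hk | hk
    · exact hxy.2 k hk
    · rw [Finset.mem_singleton.1 hk]
      exact hxy.1
  have hfin := ENNReal.toReal_mono (ENNReal.add_lt_top.2
    ⟨ENNReal.ofReal_lt_top, hlt _⟩).ne (hjoin.trans hmain)
  rw [ENNReal.toReal_add ENNReal.ofReal_ne_top (hlt _).ne, ENNReal.toReal_ofReal hε.le] at hfin
  unfold pointInc hE
  linarith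

end Prediction

section Atoms

variable {r : ℕ} {X : Type*} [MeasurableSpace X] {μ : Measure X} [IsProbabilityMeasure μ]
  {T : BorelAction (FG r) X} {a : X → ℕ}

lemma measure_fiber_le_exp_neg_le {I : Type*} [Countable I] [MeasurableSpace I]
    [MeasurableSingletonClass I] {f : X → I} (hf : Measurable f) {K : ℝ} (hK : 0 < K) :
    μ {x | μ (f ⁻¹' {f x}) ≤ ENNReal.ofReal (Real.exp (-K))} ≤ Hpart μ f / ENNReal.ofReal K := by
  have h1 : μ {x | μ (f ⁻¹' {f x}) ≤ ENNReal.ofReal (Real.exp (-K))}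
      ≤ μ {x | ENNReal.ofReal K ≤ infoFn μ f (f x)} := by
    refine measure_mono_ae ?_
    filter_upwards [ae_fiber_pos (μ := μ) f] with x hx hxK
    refine ENNReal.ofReal_le_ofReal ?_
    have h2 : (μ (f ⁻¹' {f x})).toReal ≤ Real.exp (-K) :=
      ENNReal.toReal_le_of_le_ofReal (Real.exp_pos _).le hxK
    have h3 := Real.log_le_log (ENNReal.toReal_pos hx.ne' (measure_ne_top _ _)) h2
    rw [Real.log_exp] at h3
    linarith
  rw [Hpart_eq_lintegral hf]
  exact h1.trans (meas_ge_le_lintegral_div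
    ((measurable_of_countable (infoFn μ f)).comp hf).aemeasurable (by simpa using hK)
    ENNReal.ofReal_ne_top)

/-- If the entropies of the ball joins are bounded, some itinerary class has positive measure. -/
lemma exists_itinerary_pos (ha : Measurable a) {C : ℝ}
    (hC : ∀ n, Hpart μ (T.joinF ((bF r n : Finset (FG r)) : Set (FG r)) a) ≤ ENNReal.ofReal C) :
    ∃ x, 0 < μ {y | ∀ g : FG r, a (T.act g⁻¹ y) = a (T.act g⁻¹ x)} := by
  set f := fun n => T.joinF ((bF r n : Finset (FG r)) : Set (FG r)) a with hf
  have hfm : ∀ n, Measurable (f n) := fun n => measurable_joinF ha _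
  have hanti : ∀ x, Antitone fun n => f n ⁻¹' {f n x} := by
    intro x m n hmn y hy
    have hy' : f n y = f n x := hy
    change f m y = f m x
    rw [hf, joinF_eq_iff] at hy' ⊢
    exact fun g hg => hy' g (bF_mono hmn hg)
  set K : ℝ := |C| + 1 with hK
  have hK0 : 0 < K := by positivity
  set κ : ℝ≥0∞ := ENNReal.ofReal (Real.exp (-K)) with hκ
  set bad : ℕ → Set X := fun n => {x | μ (f n ⁻¹' {f n x}) ≤ κ} with hbad
  have hmono : Monotone bad := fun m n hmn x hx => (measure_mono (hanti x hmn)).trans hx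
  have hlt : μ (⋃ n, bad n) < 1 := by
    rw [hmono.measure_iUnion]
    refine lt_of_le_of_lt (iSup_le fun n => (measure_fiber_le_exp_neg_le (hfm n) hK0).trans
      (ENNReal.div_le_div_right (hC n) _)) ?_
    rw [ENNReal.div_lt_iff (Or.inl (by simpa using hK0)) (Or.inl ENNReal.ofReal_ne_top), one_mul]
    exact (ENNReal.ofReal_lt_ofReal_iff hK0).2 (by linarith [le_abs_self C])
  obtain ⟨x, hx⟩ : ∃ x, x ∉ ⋃ n, bad n := by
    by_contra hcon
    push Not at hcon
    rw [eq_univ_of_forall hcon, measure_univ] at hlt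
    exact lt_irrefl _ hlt
  refine ⟨x, ?_⟩
  have heq : {y | ∀ g : FG r, a (T.act g⁻¹ y) = a (T.act g⁻¹ x)} = ⋂ n, f n ⁻¹' {f n x} := by
    ext y
    simp only [mem_iInter, mem_preimage, mem_singleton_iff, hf, joinF_eq_iff, mem_ofPred_eq]
    exact ⟨fun h n g _ => h g, fun h g => h (wlen g) g (mem_bF.2 le_rfl)⟩
  rw [heq, (hanti x).measure_iInter
    (fun n => (hfm n (measurableSet_singleton _)).nullMeasurableSet) ⟨0, measure_ne_top _ _⟩]
  refine lt_of_lt_of_le (b := κ) (by simpa [hκ] using Real.exp_pos _) (le_iInf fun n => ?_)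
  rw [mem_iUnion, not_exists] at hx
  exact (not_le.1 (hx n)).le

lemma mem_iff_of_partSA_univ {B : Set X} (hB : MeasurableSet[T.partSA univ a] B) {x y : X}
    (hxy : ∀ g : FG r, a (T.act g⁻¹ y) = a (T.act g⁻¹ x)) : y ∈ B ↔ x ∈ B := by
  have hle : T.partSA univ a ≤
      { MeasurableSet' := fun B => y ∈ B ↔ x ∈ B
        measurableSet_empty := Iff.rfl
        measurableSet_compl := fun B hB => not_congr hB
        measurableSet_iUnion := fun f hf => by
          rw [mem_iUnion, mem_iUnion]
          exact exists_congr hf } := by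
    refine iSup₂_le fun g _ => ?_
    rintro _ ⟨S, -, rfl⟩
    change T.tr g a y ∈ S ↔ T.tr g a x ∈ S
    rw [BorelAction.tr, BorelAction.tr, hxy g]
  exact hle B hB

variable [StandardBorelSpace X]

lemma exists_atom_of_itinerary_pos (ha : Measurable a) (hgen : T.Generating a μ) {x : X}
    (hx : 0 < μ {y | ∀ g : FG r, a (T.act g⁻¹ y) = a (T.act g⁻¹ x)}) :
    ∃ x₀, 0 < μ {x₀} := by
  set P : Set X := {y | ∀ g : FG r, a (T.act g⁻¹ y) = a (T.act g⁻¹ x)} with hP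
  have hPm : MeasurableSet P := by
    rw [hP, Set.ofPred_forall]
    exact MeasurableSet.iInter fun g =>
      (ha.comp (T.measurable_act g⁻¹)) (measurableSet_singleton (a (T.act g⁻¹ x)))
  have hprob := ProbabilityTheory.cond_isProbabilityMeasure hx.ne'
  have hac : ProbabilityTheory.cond μ P ≪ μ := ProbabilityTheory.cond_absolutelyContinuous
  have hzo : IsZeroOneMeasure (ProbabilityTheory.cond μ P) := by
    refine ⟨fun B hB => ?_⟩
    obtain ⟨B', hB', hBB'⟩ := hgen B hB
    rw [measure_congr (measure_symmDiff_eq_zero_iff.1 (hac hBB'))]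
    rw [ProbabilityTheory.cond_apply hPm]
    by_cases hxB : x ∈ B'
    · right
      have hPB : P ⊆ B' := fun y hy => (mem_iff_of_partSA_univ hB' hy).2 hxB
      rw [inter_eq_left.2 hPB]
      exact ENNReal.inv_mul_cancel hx.ne' (measure_ne_top _ _)
    · left
      have : P ∩ B' = ∅ := eq_empty_of_forall_notMem fun y hy =>
        hxB ((mem_iff_of_partSA_univ hB' hy.1).1 hy.2)
      rw [this, measure_empty, mul_zero]
  obtain ⟨x₀, hx₀⟩ := IsZeroOneMeasure.exists_eq_dirac (μ := ProbabilityTheory.cond μ P)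
  refine ⟨x₀, pos_iff_ne_zero.2 fun h0 => ?_⟩
  have := hac h0
  rw [hx₀] at this
  simp at this

lemma purelyAtomic_of_atom (hT : T.Preserves μ) (herg : T.IsErgodic μ) {x₀ : X}
    (hx₀ : 0 < μ {x₀}) : PurelyAtomic μ := by
  set A : Set X := {x | 0 < μ {x}} with hA
  have hAc : A.Countable := Measure.countable_meas_pos_of_disjoint_iUnion (μ := μ)
    (As := fun x : X => {x}) (fun x => measurableSet_singleton x)
    (fun x y hxy => disjoint_singleton.2 hxy)
  have hinv : ∀ g : FG r, T.smulSet g A = A := by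
    intro g
    ext x
    change 0 < μ {T.act g⁻¹ x} ↔ 0 < μ {x}
    rw [← (hT g⁻¹).measure_preimage (measurableSet_singleton _).nullMeasurableSet]
    have : T.act g⁻¹ ⁻¹' {T.act g⁻¹ x} = {x} := by
      ext y
      refine ⟨fun h => ?_, fun h => congrArg _ h⟩
      have h2 := congrArg (T.act g) (show T.act g⁻¹ y = T.act g⁻¹ x from h)
      rwa [act_act_inv, act_act_inv] at h2
    rw [this]
  refine (herg A hAc.measurableSet fun g => by simp [hinv]).resolve_left fun h0 => ?_
  exact hx₀.ne' (measure_mono_null (singleton_subset_iff.2 hx₀) h0)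

lemma purelyAtomic_of_Hpart_le (hT : T.Preserves μ) (herg : T.IsErgodic μ) (ha : Measurable a)
    (hgen : T.Generating a μ) {C : ℝ}
    (hC : ∀ n, Hpart μ (T.joinF ((bF r n : Finset (FG r)) : Set (FG r)) a) ≤ ENNReal.ofReal C) :
    PurelyAtomic μ := by
  obtain ⟨x, hx⟩ := exists_itinerary_pos ha hC
  obtain ⟨x₀, hx₀⟩ := exists_atom_of_itinerary_pos ha hgen hx
  exact purelyAtomic_of_atom hT herg hx₀

end Atoms

section RankOne

variable {X : Type*} [MeasurableSpace X] {μ : Measure X} {T : BorelAction (FG 1) X} {a : X → ℕ}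

lemma act_zpow_of_mem_Fx {g : FG 1} {x : X} (hx : x ∈ Fx T g) (k : ℤ) : T.act (g ^ k) x = x :=
  (T.stab x).zpow_mem (x := g) hx k

lemma exists_zpow_eq (g : FG 1) : ∃ k : ℤ, FreeGroup.of 0 ^ k = g :=
  ⟨FreeGroup.equivIntOfUnique g, FreeGroup.equivIntOfUnique.left_inv g⟩

variable [StandardBorelSpace X] [IsProbabilityMeasure μ]

lemma exists_measure_Fx_eq_one (herg : T.IsErgodic μ) (hfree : ¬ T.EssentiallyFree μ) :
    ∃ g, g ≠ 1 ∧ μ (Fx T g) = 1 := by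
  by_contra! hcon
  have hzero : ∀ g : {g : FG 1 // g ≠ 1}, μ (Fx T g) = 0 := by
    intro g
    refine (herg _ (measurableSet_Fx g.1) fun h => ?_).resolve_right (hcon g g.2)
    have hcomm : h * g * h⁻¹ = g := by
      obtain ⟨k, rfl⟩ := exists_zpow_eq h
      obtain ⟨l, hl⟩ := exists_zpow_eq g.1
      rw [← hl]
      group
    rw [BorelAction.smulSet, preimage_Fx, hcomm]
    simp
  refine hfree ?_
  have hset : {x | ∀ g : FG 1, g ≠ 1 → T.act g x ≠ x} = (⋃ g : {g : FG 1 // g ≠ 1}, Fx T g)ᶜ := by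
    ext x
    simp [Fx]
  rw [BorelAction.EssentiallyFree, hset]
  have hm : MeasurableSet (⋃ g : {g : FG 1 // g ≠ 1}, Fx T g) :=
    MeasurableSet.iUnion fun g => measurableSet_Fx g.1
  exact (prob_compl_eq_one_iff hm).2 (measure_iUnion_null hzero)

lemma exists_Hpart_joinF_le_rank_one (hT : T.Preserves μ) (herg : T.IsErgodic μ)
    (hfree : ¬ T.EssentiallyFree μ) (ha : Measurable a) (hH : Hpart μ a < ⊤) :
    ∃ C : ℝ, ∀ n, Hpart μ (T.joinF ((bF 1 n : Finset (FG 1)) : Set (FG 1)) a)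
      ≤ ENNReal.ofReal C := by
  classical
  obtain ⟨g, hg, hg1⟩ := exists_measure_Fx_eq_one herg hfree
  obtain ⟨k, rfl⟩ := exists_zpow_eq g
  have hk : k ≠ 0 := by
    rintro rfl
    simp at hg
  set E : Finset (FG 1) := (Finset.Ico 0 |k|).image fun j : ℤ => FreeGroup.of (0 : Fin 1) ^ j
  have hlt := Hpart_joinF_lt_top (μ := μ) hT ha hH E
  refine ⟨(Hpart μ (T.joinF (E : Set (FG 1)) a)).toReal, fun n => ?_⟩
  rw [ENNReal.ofReal_toReal hlt.ne]
  refine Hpart_le_of_determined (s := Fx T _) (measurable_joinF ha _) (measurable_joinF ha _)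
    (mem_ae_iff.2 ((prob_compl_eq_zero_iff (measurableSet_Fx _)).2 hg1)) ?_
  intro x hx y hy hxy
  rw [joinF_eq_iff] at hxy ⊢
  intro h _
  obtain ⟨m, rfl⟩ := exists_zpow_eq h
  have hred : (FreeGroup.of (0 : Fin 1) ^ m)⁻¹
      = (FreeGroup.of (0 : Fin 1) ^ (m % k))⁻¹ * (FreeGroup.of (0 : Fin 1) ^ k) ^ (-(m / k)) := by
    rw [← zpow_neg, ← zpow_neg, ← zpow_mul, ← zpow_add]
    congr 1
    have := Int.emod_add_mul_ediv m k
    linarith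
  rw [hred, T.act_mul, T.act_mul, act_zpow_of_mem_Fx hx, act_zpow_of_mem_Fx hy]
  refine hxy _ (Finset.mem_coe.2 (Finset.mem_image_of_mem _ (Finset.mem_Ico.2
    ⟨Int.emod_nonneg _ hk, Int.emod_lt_abs _ hk⟩)))

end RankOne

/-- An ergodic action with defined, finite f-invariant entropy is either
essentially free or purely atomic. -/
theorem statement18 {r : ℕ} (hr : 1 ≤ r) {X : Type*}
    [mX : MeasurableSpace X] [StandardBorelSpace X]
    (μ : Measure X) [IsProbabilityMeasure μ]
    (T : BorelAction (FG r) X) (hT : T.Preserves μ)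
    (herg : T.IsErgodic μ)
    (hdef : ∃ a : X → ℕ, Measurable a ∧ T.Generating a μ ∧ Hpart μ a < ⊤ ∧
      fInv μ T a ≠ ⊥) :
    T.EssentiallyFree μ ∨ PurelyAtomic μ := by
  obtain ⟨a, ha, hgen, hH, hf⟩ := hdef
  refine or_iff_not_imp_left.2 fun hfree => ?_
  obtain ⟨C, hC⟩ : ∃ C : ℝ, ∀ n,
      Hpart μ (T.joinF ((bF r n : Finset (FG r)) : Set (FG r)) a) ≤ ENNReal.ofReal C := by
    rcases hr.eq_or_lt with rfl | hr2
    · exact exists_Hpart_joinF_le_rank_one hT herg hfree ha hH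
    · obtain ⟨f, hf⟩ := exists_le_fBall ha hf
      obtain ⟨C, hC⟩ := (entropyLike_hE hT ha hH).bounded_of_pointInc hr2 hf fun ε hε =>
        exists_pointInc_le hr hT (measure_fixHead_eq_one hr2 hT herg hfree) ha hH hgen hε
      refine ⟨C, fun n => ?_⟩
      rw [← ENNReal.ofReal_toReal (Hpart_joinF_lt_top hT ha hH (bF r n)).ne]
      exact ENNReal.ofReal_le_ofReal (hC n)
  exact purelyAtomic_of_Hpart_le hT herg ha hgen hC

end FPaper
end
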